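/- For complex ν with Re ν > -1: ∫_{-1}^1 [P_ν(x)]² P_ν(-x) (1-x²)^{(ν-1)/2} dx = (P_ν(0)/2^ν)³ · ∫_{-1}^1 (1-x²)^{(ν-1)/2} dx. -/

import Mathlib

section FrozenPart

open Real MeasureTheory intervalIntegral Complex

/-- Complete elliptic integral of the first kind. -/
noncomputable def ellipticK (k : ℝ) : ℝ :=
  ∫ θ in (0:ℝ)..(π/2), (1 - k ^ 2 * Real.sin θ ^ 2) ^ (-(1/2 : ℝ))

/-- Complete elliptic integral of the second kind. -/
noncomputable def ellipticE (k : ℝ) : ℝ :=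
  ∫ θ in (0:ℝ)..(π/2), (1 - k ^ 2 * Real.sin θ ^ 2) ^ ((1/2 : ℝ))

/-- Legendre function of the first kind of degree ν : P_ν(1-2z) = ₂F₁(-ν, ν+1; 1; z). -/
noncomputable def legendreP (ν : ℂ) (x : ℂ) : ℂ :=
  ordinaryHypergeometric (-ν) (ν + 1) 1 ((1 - x) / 2)

end FrozenPart

section HelperPart

open MeasureTheory Set Filter Topology

theorem hs_congr {ι R : Type*} [AddCommMonoid R] [TopologicalSpace R] {f g : ι → R} {a b : R}
    (h : HasSum f a) (hf : ∀ n, g n = f n) (hb : b = a) : HasSum g b := by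
  rw [hb, show g = f from funext hf]; exact h

/-- positive-term exchange, version 1 -/
theorem T_v1 {f : ℕ → ℝ → ℝ} {g : ℝ → ℝ} {V : ℝ} {s : Set ℝ} (hs : MeasurableSet s)
    (hf : ∀ n, IntegrableOn (f n) s) (hpos : ∀ n, ∀ x ∈ s, 0 ≤ f n x)
    (hsum : ∀ x ∈ s, HasSum (fun n => f n x) (g x))
    (hV : HasSum (fun n => ∫ x in s, f n x) V) :
    ∫ x in s, g x = V := by
  have hn : ∀ n, ∫ x in s, ‖f n x‖ = ∫ x in s, f n x := fun n =>
    setIntegral_congr_fun hs (fun x hx => by simp [abs_of_nonneg (hpos n x hx)])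
  have h := hasSum_integral_of_summable_integral_norm (μ := volume.restrict s) (F := f) hf
    (by simp_rw [hn]; exact hV.summable)
  have h2 : ∫ x in s, ∑' n, f n x = ∫ x in s, g x :=
    setIntegral_congr_fun hs (fun x hx => (hsum x hx).tsum_eq)
  rw [h2] at h
  exact h.unique hV

/-- positive-term exchange, version 2 -/
theorem T_v2 {f : ℕ → ℝ → ℝ} {g : ℝ → ℝ} {s : Set ℝ} (hs : MeasurableSet s)
    (hf : ∀ n, IntegrableOn (f n) s) (hpos : ∀ n, ∀ x ∈ s, 0 ≤ f n x)
    (hsum : ∀ x ∈ s, HasSum (fun n => f n x) (g x))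
    (hg : IntegrableOn g s) :
    HasSum (fun n => ∫ x in s, f n x) (∫ x in s, g x) := by
  have hn : ∀ n, ∫ x in s, ‖f n x‖ = ∫ x in s, f n x := fun n =>
    setIntegral_congr_fun hs (fun x hx => by simp [abs_of_nonneg (hpos n x hx)])
  have hsm : Summable (fun n => ∫ x in s, f n x) := by
    refine summable_of_sum_le (c := ∫ x in s, g x)
      (fun n => setIntegral_nonneg hs (hpos n)) (fun u => ?_)
    rw [← integral_finsetSum _ (fun n _ => hf n)]
    refine setIntegral_mono_on (integrable_finsetSum _ (fun n _ => hf n)) hg hs (fun x hx => ?_)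
    exact sum_le_hasSum _ (fun n _ => hpos n x hx) (hsum x hx)
  have := T_v1 hs hf hpos hsum hsm.hasSum
  rw [this]; exact hsm.hasSum

theorem beta_int {u v : ℝ} (hu : 0 < u) (hv : 0 < v) :
    IntegrableOn (fun x : ℝ => x ^ (u - 1) * (1 - x) ^ (v - 1)) (Ioo 0 1) ∧
    ∫ x in Ioo (0:ℝ) 1, x ^ (u - 1) * (1 - x) ^ (v - 1)
      = Real.Gamma u * Real.Gamma v / Real.Gamma (u + v) := by
  have hc := Complex.betaIntegral_convergent (u := u) (v := v) (by simpa) (by simpa)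
  rw [intervalIntegrable_iff_integrableOn_Ioo_of_le zero_le_one] at hc
  have he : ∀ x ∈ Ioo (0:ℝ) 1, ((x:ℂ) ^ ((u:ℂ) - 1) * (1 - (x:ℂ)) ^ ((v:ℂ) - 1))
      = ((x ^ (u - 1) * (1 - x) ^ (v - 1) : ℝ) : ℂ) := by
    intro x hx
    have h1 := Complex.ofReal_cpow hx.1.le (u - 1)
    have h2 := Complex.ofReal_cpow (sub_nonneg.2 hx.2.le) (v - 1)
    push_cast at h1 h2 ⊢
    rw [h1, h2]
  have hc2 : IntegrableOn (fun x : ℝ => ((x ^ (u - 1) * (1 - x) ^ (v - 1) : ℝ) : ℂ)) (Ioo 0 1) :=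
    hc.congr_fun he measurableSet_Ioo
  have hb := Complex.betaIntegral_eq_Gamma_mul_div u v (by simpa) (by simpa)
  rw [Complex.betaIntegral, intervalIntegral.integral_of_le zero_le_one,
    integral_Ioc_eq_integral_Ioo, setIntegral_congr_fun measurableSet_Ioo he,
    integral_complex_ofReal] at hb
  refine ⟨?_, ?_⟩
  · have : IntegrableOn (fun x : ℝ => RCLike.re ((x ^ (u - 1) * (1 - x) ^ (v - 1) : ℝ) : ℂ)) (Ioo 0 1) := hc2.re
    exact this.congr_fun (fun x _ => by simp) measurableSet_Ioo
  · rw [Complex.Gamma_ofReal, Complex.Gamma_ofReal, ← Complex.ofReal_add, Complex.Gamma_ofReal] at hb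
    exact_mod_cast hb

theorem Gamma_add_nat {A : ℝ} (hA : 0 < A) (k : ℕ) :
    Real.Gamma (A + k) = Real.Gamma A * (ascPochhammer ℝ k).eval A := by
  induction k with
  | zero => simp
  | succ k ih =>
    rw [ascPochhammer_succ_eval]
    push_cast
    rw [← add_assoc, Real.Gamma_add_one (by positivity), ih]; ring

/-- binomial series -/
theorem binom_hasSum {A t : ℝ} (hA : 0 < A) (ht0 : 0 ≤ t) (ht : t < 1) :
    HasSum (fun k : ℕ => Real.Gamma (A + k) / k.factorial * t ^ k)
      (Real.Gamma A * (1 - t) ^ (-A)) := by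
  have h := (Real.one_div_one_sub_rpow_hasFPowerSeriesOnBall_zero A).hasSum (y := t)
    (by rw [← ENNReal.ofReal_one, Metric.eball_ofReal]; simp [abs_of_nonneg ht0, ht])
  refine hs_congr (h.mul_left (Real.Gamma A)) (fun k => ?_) ?_
  · rw [FormalMultilinearSeries.ofScalars_apply_eq, Gamma_add_nat hA]
    have h1 := Ring.factorial_nsmul_multichoose_eq_ascPochhammer A k
    rw [Ring.choose, show A + k - 1 - k + 1 = A by ring]
    rw [Polynomial.ascPochhammer_smeval_eq_eval] at h1
    rw [← h1]
    have := k.factorial_pos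
    simp only [nsmul_eq_mul, smul_eq_mul]
    field_simp
  · rw [zero_add, Real.rpow_neg (by linarith)]; simp

theorem gauss {A B C : ℝ} (hA : 0 < A) (hB : 0 < B) (hC : A + B < C) :
    HasSum (fun k : ℕ => Real.Gamma (A + k) * Real.Gamma (B + k) /
        (k.factorial * Real.Gamma (C + k)))
      (Real.Gamma A * Real.Gamma B * Real.Gamma (C - A - B) /
        (Real.Gamma (C - A) * Real.Gamma (C - B))) := by
  have key := T_v2 (s := Ioo (0:ℝ) 1)
    (f := fun k t => Real.Gamma (A + k) / k.factorial * (t ^ (B + k - 1) * (1 - t) ^ (C - B - 1)))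
    (g := fun t => Real.Gamma A * (t ^ (B - 1) * (1 - t) ^ (C - A - B - 1))) measurableSet_Ioo
    (fun k => (beta_int (by positivity) (by linarith)).1.const_mul _)
    (fun k x hx => by
      have h1 := Real.Gamma_pos_of_pos (show 0 < A + k by positivity)
      have h2 := Real.rpow_nonneg hx.1.le (B + k - 1)
      have h3 := Real.rpow_nonneg (sub_nonneg.2 hx.2.le) (C - B - 1)
      positivity)
    (fun t ht => by
      have h := (binom_hasSum hA ht.1.le ht.2).mul_right (t ^ (B - 1) * (1 - t) ^ (C - B - 1))
      refine hs_congr h (fun k => ?_) ?_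
      · rw [show B + k - 1 = (B - 1) + k by ring, Real.rpow_add_natCast ht.1.ne']; ring
      · rw [show C - A - B - 1 = -A + (C - B - 1) by ring,
          Real.rpow_add (sub_pos.2 ht.2)]; ring)
    ((beta_int hB (by linarith)).1.const_mul _)
  have hCB := Real.Gamma_pos_of_pos (show 0 < C - B by linarith)
  refine hs_congr (key.mul_right (1 / Real.Gamma (C - B))) (fun k => ?_) ?_
  · rw [integral_const_mul, (beta_int (by positivity) (by linarith)).2,
      show B + k + (C - B) = C + k by ring]
    field_simp
  · rw [integral_const_mul, (beta_int hB (by linarith)).2,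
      show B + (C - A - B) = C - A by ring]
    field_simp

/-- product defining the coefficients -/
noncomputable def gam {K : Type*} [Field K] (l : K) (k : ℕ) : K :=
  ∏ i ∈ Finset.range k, ((i : K) * (i + 1) + l)

/-- coefficients -/
noncomputable def cc {K : Type*} [Field K] (l : K) (k : ℕ) : K := gam l k / (k.factorial : K) ^ 2

theorem gam_succ {K : Type*} [Field K] (l : K) (k : ℕ) :
    gam l (k + 1) = gam l k * ((k : K) * (k + 1) + l) := by
  simp [gam, Finset.prod_range_succ]

theorem gam_zero {K : Type*} [Field K] (l : K) : gam l 0 = 1 := by simp [gam]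

theorem gam_coef (m n r : ℕ) (hr : r ≤ n) :
    ((m + n + 1).choose (r + 1) : ℝ) * ((n + 1).descFactorial (r + 1) : ℝ) *
        (m.descFactorial (r + 1) : ℝ)
      = ((m + n).choose (r + 1) : ℝ) * (n.descFactorial (r + 1) : ℝ) * (m.descFactorial (r + 1) : ℝ)
        - ((m + n).choose r : ℝ) * (n.descFactorial r : ℝ) * (m.descFactorial r : ℝ) *
          ((n : ℝ) * (n + 1) - ((m + n - r : ℕ) : ℝ) * ((m + n - r : ℕ) + 1)) := by
  rcases Nat.lt_or_ge m r with h | h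
  · have h1 : m.descFactorial r = 0 := Nat.descFactorial_eq_zero_iff_lt.2 h
    have h2 : m.descFactorial (r + 1) = 0 := Nat.descFactorial_eq_zero_iff_lt.2 (by omega)
    simp [h1, h2]
  · have e1 : (m.descFactorial (r + 1) : ℝ) = (m - r) * m.descFactorial r := by
      rw [Nat.descFactorial_succ]; push_cast [h]; ring
    have e2 : (n.descFactorial (r + 1) : ℝ) = (n - r) * n.descFactorial r := by
      rw [Nat.descFactorial_succ]; push_cast [hr]; ring
    have e3 : ((n + 1).descFactorial (r + 1) : ℝ) = (n + 1) * n.descFactorial r := by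
      rw [Nat.succ_descFactorial_succ]; push_cast; ring
    have e4 : ((m + n).choose (r + 1) : ℝ) * (r + 1) = (m + n).choose r * (m + n - r) := by
      have := Nat.choose_succ_right_eq (m + n) r
      have h' : r ≤ m + n := by omega
      have := congrArg (fun x : ℕ => (x : ℝ)) this
      push_cast [h'] at this; linarith
    have e5 : ((m + n + 1).choose (r + 1) : ℝ) * (r + 1) = (m + n + 1) * (m + n).choose r := by
      have := Nat.add_one_mul_choose_eq (m + n) r
      have := congrArg (fun x : ℕ => (x : ℝ)) this
      push_cast at this; linarith
    have e6 : ((m + n - r : ℕ) : ℝ) = m + n - r := by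
      rw [Nat.cast_sub (by omega)]; push_cast; ring
    have hr1 : ((r : ℝ) + 1) ≠ 0 := by positivity
    rw [e1, e2, e3, e6]
    apply mul_right_cancel₀ hr1
    linear_combination ((n : ℝ) + 1) * n.descFactorial r * ((m - r) * m.descFactorial r) * e5
      - ((n : ℝ) - r) * n.descFactorial r * ((m - r) * m.descFactorial r) * e4

theorem gam_mul (l : ℝ) (m n : ℕ) :
    gam l m * gam l n = ∑ r ∈ Finset.range (n + 1), (-1 : ℝ) ^ r * (m + n).choose r *
      n.descFactorial r * m.descFactorial r * gam l (m + n - r) := by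
  induction n with
  | zero => simp [gam_zero]
  | succ n ih =>
    rw [gam_succ, ← mul_assoc, ih, Finset.sum_mul]
    have h1 : ∀ r ∈ Finset.range (n + 1), (-1 : ℝ) ^ r * (m + n).choose r *
      n.descFactorial r * m.descFactorial r * gam l (m + n - r) * ((n : ℝ) * (n + 1) + l)
      = (-1 : ℝ) ^ r * (m + n).choose r *
      n.descFactorial r * m.descFactorial r * gam l (m + (n + 1) - r) +
      (-1 : ℝ) ^ r * (m + n).choose r *
      n.descFactorial r * m.descFactorial r *
        ((n : ℝ) * (n + 1) - ((m + n - r : ℕ) : ℝ) * ((m + n - r : ℕ) + 1)) * gam l (m + n - r) := by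
      intro r hr
      have : r ≤ n := by simpa [Nat.lt_succ_iff] using hr
      rw [show m + (n + 1) - r = (m + n - r) + 1 by omega, gam_succ]; ring
    rw [Finset.sum_congr rfl h1, Finset.sum_add_distrib]
    have h2 : ∑ r ∈ Finset.range (n + 1), (-1 : ℝ) ^ r * (m + n).choose r *
      n.descFactorial r * m.descFactorial r * gam l (m + (n + 1) - r)
      = ∑ r ∈ Finset.range (n + 2), (-1 : ℝ) ^ r * (m + n).choose r *
      n.descFactorial r * m.descFactorial r * gam l (m + (n + 1) - r) := by
      rw [Finset.sum_range_succ _ (n + 1)]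
      have : n.descFactorial (n + 1) = 0 := Nat.descFactorial_eq_zero_iff_lt.2 (by omega)
      simp [this]
    rw [h2, Finset.sum_range_succ' _ (n + 1), Finset.sum_range_succ' _ (n + 1), add_right_comm,
      ← Finset.sum_add_distrib]
    congr 1
    · refine Finset.sum_congr rfl (fun r hr => ?_)
      have hr' : r ≤ n := by simpa [Nat.lt_succ_iff] using hr
      have := gam_coef m n r hr'
      rw [show m + (n + 1) - (r + 1) = m + n - r by omega, show m + (n + 1) = m + n + 1 by ring,
        pow_succ]
      linear_combination ((-1 : ℝ) ^ r * gam l (m + n - r)) * this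
    · simp

theorem sum_pascal (m : ℕ) (h : ℕ → ℝ) :
    ∑ q ∈ Finset.range (m + 2), ((m + 1).choose q : ℝ) * h q
      = ∑ q ∈ Finset.range (m + 1), (m.choose q : ℝ) * (h q + h (q + 1)) := by
  rw [Finset.sum_range_succ']
  simp_rw [mul_add, Finset.sum_add_distrib]
  have : ∑ q ∈ Finset.range (m + 1), (m.choose q : ℝ) * h q
      = ∑ q ∈ Finset.range (m + 1), (m.choose (q + 1) : ℝ) * h (q + 1) + h 0 := by
    have h2 : ∑ q ∈ Finset.range (m + 1), (m.choose q : ℝ) * h q =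
      ∑ q ∈ Finset.range (m + 2), (m.choose q : ℝ) * h q := by
      rw [Finset.sum_range_succ _ (m + 1)]; simp
    rw [h2, Finset.sum_range_succ']; simp
  rw [this]
  simp_rw [Nat.choose_succ_succ, Nat.cast_add, add_mul, Finset.sum_add_distrib]
  simp; ring

theorem sum_vander (m n : ℕ) (g : ℕ → ℝ) :
    ∑ q ∈ Finset.range (m + 1), ∑ p ∈ Finset.range (n + 1), (m.choose q : ℝ) * n.choose p * g (q + p)
      = ∑ r ∈ Finset.range (m + n + 1), ((m + n).choose r : ℝ) * g r := by
  induction m generalizing g with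
  | zero => simp
  | succ m ih =>
    have h0 := sum_pascal m (fun q => ∑ p ∈ Finset.range (n + 1), (n.choose p : ℝ) * g (q + p))
    simp_rw [Finset.mul_sum, ← mul_assoc] at h0
    rw [h0, show m + 1 + n + 1 = (m + n) + 2 by ring, show m + 1 + n = m + n + 1 by ring,
      sum_pascal, ← ih (fun r => g r + g (r + 1))]
    refine Finset.sum_congr rfl (fun q _ => ?_)
    rw [← Finset.sum_add_distrib, Finset.mul_sum]
    refine Finset.sum_congr rfl (fun p _ => ?_)
    rw [show q + 1 + p = q + p + 1 by ring]; ring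

theorem fiber_term (m n q p : ℕ) (hq : q ≤ m) (hp : p ≤ n) :
    ((m - q).choose p : ℝ) * (n - p).choose q / (((m - q).factorial : ℝ) ^ 2 * ((n - p).factorial : ℝ) ^ 2)
      = (m.choose q : ℝ) * n.choose p * (m.descFactorial (q + p) * n.descFactorial (q + p)) /
        ((m.factorial : ℝ) ^ 2 * (n.factorial : ℝ) ^ 2) := by
  rcases Nat.lt_or_ge m (q + p) with h | h
  · have h1 : m.descFactorial (q + p) = 0 := Nat.descFactorial_eq_zero_iff_lt.2 h
    have h2 : (m - q).choose p = 0 := Nat.choose_eq_zero_of_lt (by omega)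
    simp [h1, h2]
  rcases Nat.lt_or_ge n (q + p) with h' | h'
  · have h1 : n.descFactorial (q + p) = 0 := Nat.descFactorial_eq_zero_iff_lt.2 h'
    have h2 : (n - p).choose q = 0 := Nat.choose_eq_zero_of_lt (by omega)
    simp [h1, h2]
  have a1 : (((m - q).choose p : ℕ) : ℝ) = (m - q).factorial / (p.factorial * (m - (q + p)).factorial) := by
    rw [Nat.cast_choose ℝ (by omega), show m - q - p = m - (q + p) by omega]
  have a2 : (((n - p).choose q : ℕ) : ℝ) = (n - p).factorial / (q.factorial * (n - (q + p)).factorial) := by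
    rw [Nat.cast_choose ℝ (by omega), show n - p - q = n - (q + p) by omega]
  have a3 : ((m.choose q : ℕ) : ℝ) = m.factorial / (q.factorial * (m - q).factorial) :=
    Nat.cast_choose ℝ hq
  have a4 : ((n.choose p : ℕ) : ℝ) = n.factorial / (p.factorial * (n - p).factorial) :=
    Nat.cast_choose ℝ hp
  have f0 : ∀ x : ℕ, (x.factorial : ℝ) ≠ 0 := fun x => by positivity
  have a5 : (m.descFactorial (q + p) : ℝ) = m.factorial / (m - (q + p)).factorial := by
    rw [eq_div_iff (f0 _), mul_comm]; exact_mod_cast Nat.factorial_mul_descFactorial h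
  have a6 : (n.descFactorial (q + p) : ℝ) = n.factorial / (n - (q + p)).factorial := by
    rw [eq_div_iff (f0 _), mul_comm]; exact_mod_cast Nat.factorial_mul_descFactorial h'
  rw [a1, a2, a3, a4, a5, a6]
  have := f0 m; have := f0 n; have := f0 q; have := f0 p; have := f0 (m - q); have := f0 (n - p)
  have := f0 (m - (q + p)); have := f0 (n - (q + p))
  field_simp

theorem fiber_sum (l : ℝ) (m n : ℕ) :
    ∑ x ∈ Finset.HasAntidiagonal.antidiagonal m, ∑ y ∈ Finset.HasAntidiagonal.antidiagonal n,
      cc l (x.1 + y.1) * ((x.1 + y.1).choose x.1 : ℝ) ^ 2 *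
        ((x.1.choose y.2 : ℝ) * (y.1.choose x.2 : ℝ) * (-1) ^ (x.2 + y.2)) = cc l m * cc l n := by
  have h0 : cc l m * cc l n = ∑ r ∈ Finset.range (m + n + 1), ((m + n).choose r : ℝ) *
      ((-1 : ℝ) ^ r * n.descFactorial r * m.descFactorial r * gam l (m + n - r) /
        ((m.factorial : ℝ) ^ 2 * (n.factorial : ℝ) ^ 2)) := by
    have : cc l m * cc l n = gam l m * gam l n / ((m.factorial : ℝ) ^ 2 * (n.factorial : ℝ) ^ 2) := by
      unfold cc; field_simp
    rw [this, gam_mul, Finset.sum_div]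
    refine (Finset.sum_congr rfl (fun r _ => ?_)).trans
      (Finset.sum_subset (s₁ := Finset.range (n + 1)) ?_ ?_)
    · ring
    · intro x; simp only [Finset.mem_range]; omega
    · intro x _ hx
      have : n.descFactorial x = 0 := Nat.descFactorial_eq_zero_iff_lt.2 (by simpa using hx)
      simp [this]
  rw [h0, ← sum_vander]
  rw [← Finset.Nat.sum_antidiagonal_swap]
  rw [Finset.Nat.sum_antidiagonal_eq_sum_range_succ_mk]
  refine Finset.sum_congr rfl (fun q hq => ?_)
  rw [← Finset.Nat.sum_antidiagonal_swap]
  rw [Finset.Nat.sum_antidiagonal_eq_sum_range_succ_mk]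
  refine Finset.sum_congr rfl (fun p hp => ?_)
  have hq' : q ≤ m := by simpa [Nat.lt_succ_iff] using hq
  have hp' : p ≤ n := by simpa [Nat.lt_succ_iff] using hp
  have h1 := fiber_term m n q p hq' hp'
  simp only [Prod.swap]
  have h2 : cc l (m - q + (n - p)) * ((m - q + (n - p)).choose (m - q) : ℝ) ^ 2
      = gam l (m + n - (q + p)) / (((m - q).factorial : ℝ) ^ 2 * ((n - p).factorial : ℝ) ^ 2) := by
    rw [Nat.cast_add_choose, cc, show m - q + (n - p) = m + n - (q + p) by omega]
    have : ((m + n - (q + p)).factorial : ℝ) ≠ 0 := by positivity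
    field_simp
  rw [h2]
  linear_combination ((-1 : ℝ) ^ (q + p) * gam l (m + n - (q + p))) * h1

open Polynomial in
theorem coeff_lin_pow (a b : ℝ) (k j : ℕ) :
    ((C a + C b * X) ^ k : ℝ[X]).coeff j = (k.choose j : ℝ) * a ^ (k - j) * b ^ j := by
  rw [add_comm, add_pow, finsetSum_coeff]
  have : ∀ i ∈ Finset.range (k + 1), (((C b * X) ^ i * C a ^ (k - i) * (k.choose i : ℝ[X])) : ℝ[X]).coeff j
      = if j = i then (k.choose i : ℝ) * a ^ (k - i) * b ^ i else 0 := by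
    intro i _
    rw [mul_pow, ← C_pow, ← C_pow, show (C (b ^ i) * X ^ i * C (a ^ (k - i)) * (k.choose i : ℝ[X]) : ℝ[X])
      = C ((k.choose i : ℝ) * a ^ (k - i) * b ^ i) * X ^ i by
        simp only [map_mul, map_natCast]; ring, coeff_C_mul_X_pow]
  rw [Finset.sum_congr rfl this, Finset.sum_ite_eq]
  split_ifs with h
  · rfl
  · rw [Nat.choose_eq_zero_of_lt (by simpa using h)]; simp

open Polynomial in
theorem pk_identity (A B : ℝ) (h : A + B = 1) (k : ℕ) :
    ∑ x ∈ Finset.HasAntidiagonal.antidiagonal k, ((x.1 + x.2).choose x.1 : ℝ) ^ 2 * (A ^ 2) ^ x.1 * (B ^ 2) ^ x.2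
      = ∑ j ∈ Finset.range (k + 1), (k.choose j : ℝ) * ((-1) ^ j * (2 * j).choose j * (A * B) ^ j) := by
  have e : (C B + C A * X) * (C A + C B * X) = C (A * B) * (1 - X) ^ 2 + (X : ℝ[X]) := by
    have hB : B = 1 - A := by linarith
    subst hB
    simp only [map_sub, map_mul, map_one]; ring
  have e2 := congrArg (fun p : ℝ[X] => (p ^ k).coeff k) e
  simp only [mul_pow, coeff_mul] at e2
  rw [show ∑ x ∈ Finset.HasAntidiagonal.antidiagonal k, ((x.1 + x.2).choose x.1 : ℝ) ^ 2 * (A ^ 2) ^ x.1 * (B ^ 2) ^ x.2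
    = ∑ x ∈ Finset.HasAntidiagonal.antidiagonal k, ((C B + C A * X) ^ k : ℝ[X]).coeff x.1 *
        ((C A + C B * X) ^ k : ℝ[X]).coeff x.2 from ?_, e2, add_pow, finsetSum_coeff]
  · refine Finset.sum_congr rfl (fun j hj => ?_)
    have hj' : j ≤ k := by simpa [Nat.lt_succ_iff] using hj
    rw [mul_pow, ← pow_mul, ← C_pow, show (C ((A * B) ^ j) * (1 - X) ^ (2 * j) * X ^ (k - j) * (k.choose j : ℝ[X]) : ℝ[X])
      = C ((k.choose j : ℝ) * (A * B) ^ j) * ((C 1 + C (-1) * X) ^ (2 * j) * X ^ (k - j)) by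
        simp only [map_mul, map_natCast, map_neg, map_one]; ring, coeff_C_mul]
    have := coeff_mul_X_pow ((C 1 + C (-1) * X) ^ (2 * j) : ℝ[X]) (k - j) j
    rw [show j + (k - j) = k by omega] at this
    rw [this, coeff_lin_pow]
    ring
  · refine Finset.sum_congr rfl (fun x hx => ?_)
    rw [Finset.HasAntidiagonal.mem_antidiagonal] at hx
    rw [coeff_lin_pow, coeff_lin_pow, ← hx]
    rw [show x.1 + x.2 - x.1 = x.2 by omega, show x.1 + x.2 - x.2 = x.1 by omega,
      Nat.choose_symm_add]
    ring

theorem cc_zero {K : Type*} [Field K] (l : K) : cc l 0 = 1 := by simp [cc, gam_zero]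

theorem cc_succ {K : Type*} [Field K] [CharZero K] (l : K) (k : ℕ) :
    cc l (k + 1) * ((k : K) + 1) ^ 2 = cc l k * ((k : K) * (k + 1) + l) := by
  have h1 : ((k.factorial : ℕ) : K) ≠ 0 := by exact_mod_cast k.factorial_ne_zero
  have h2 : ((k : K) + 1) ≠ 0 := by exact_mod_cast k.succ_ne_zero
  unfold cc
  rw [gam_succ, Nat.factorial_succ]
  push_cast
  field_simp

theorem cc_nonneg {l : ℝ} (h0 : 0 ≤ l) (k : ℕ) : 0 ≤ cc l k := by
  unfold cc gam
  apply div_nonneg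
  · exact Finset.prod_nonneg (fun i _ => by positivity)
  · positivity

theorem cc_le_one {l : ℝ} (h0 : 0 ≤ l) (h1 : l ≤ 1) (k : ℕ) : cc l k ≤ 1 := by
  induction k with
  | zero => simp [cc_zero]
  | succ k ih =>
    have h := cc_succ l k
    have h2 := cc_nonneg h0 k
    have h3 : (0 : ℝ) ≤ k := by positivity
    have h4 : cc l (k + 1) * ((k : ℝ) + 1) ^ 2 ≤ 1 * ((k : ℝ) + 1) ^ 2 := by
      rw [h]
      apply mul_le_mul ih _ (by positivity) zero_le_one
      nlinarith
    exact le_of_mul_le_mul_right h4 (by positivity)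

/-- double coefficients -/
noncomputable def dd (l : ℝ) (x : ℕ × ℕ) : ℝ := cc l (x.1 + x.2) * ((x.1 + x.2).choose x.1 : ℝ) ^ 2

theorem dd_nonneg {l : ℝ} (h0 : 0 ≤ l) (x : ℕ × ℕ) : 0 ≤ dd l x :=
  mul_nonneg (cc_nonneg h0 _) (by positivity)

theorem choose_term_le {s t : ℝ} (hs : 0 ≤ s) (ht : 0 ≤ t) (i j : ℕ) :
    ((i + j).choose i : ℝ) * (s ^ i * t ^ j) ≤ (s + t) ^ (i + j) := by
  rw [add_pow]
  have := Finset.single_le_sum (f := fun m => s ^ m * t ^ (i + j - m) * ((i + j).choose m : ℝ))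
    (s := Finset.range (i + j + 1)) (fun m _ => by positivity) (a := i) (by simp)
  simp only [Nat.add_sub_cancel_left] at this
  linarith

theorem dd_bound {l : ℝ} (h0 : 0 ≤ l) (h1 : l ≤ 1) {θ A B : ℝ} (hθ : 0 < θ) (hθ' : θ < 1)
    (hA : 0 ≤ A) (hB : 0 ≤ B) (x : ℕ × ℕ) :
    dd l x * (A ^ x.1 * B ^ x.2) ≤ (A / θ + B / (1 - θ)) ^ (x.1 + x.2) := by
  obtain ⟨i, j⟩ := x
  have hb : 0 < 1 - θ := by linarith
  have e1 := choose_term_le hθ.le hb.le i j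
  have e2 := choose_term_le (s := A / θ) (t := B / (1 - θ)) (by positivity) (by positivity) i j
  have e3 : θ + (1 - θ) = 1 := by ring
  rw [e3, one_pow] at e1
  have e4 : ((i + j).choose i : ℝ) ^ 2 * (A ^ i * B ^ j) = (((i + j).choose i : ℝ) * (θ ^ i * (1 - θ) ^ j)) *
    (((i + j).choose i : ℝ) * ((A / θ) ^ i * (B / (1 - θ)) ^ j)) := by
    rw [div_pow, div_pow]; field_simp
  simp only [dd]
  calc cc l (i + j) * ((i + j).choose i : ℝ) ^ 2 * (A ^ i * B ^ j)
      = cc l (i + j) * (((i + j).choose i : ℝ) ^ 2 * (A ^ i * B ^ j)) := by ring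
    _ ≤ 1 * (((i + j).choose i : ℝ) ^ 2 * (A ^ i * B ^ j)) := by
        gcongr; exact cc_le_one h0 h1 _
    _ = _ := one_mul _
    _ ≤ 1 * (((i + j).choose i : ℝ) * ((A / θ) ^ i * (B / (1 - θ)) ^ j)) := by
        rw [e4]; gcongr
    _ ≤ _ := by rw [one_mul]; exact e2

theorem summable_pow_add {ρ : ℝ} (h0 : 0 ≤ ρ) (h1 : ρ < 1) :
    Summable (fun x : ℕ × ℕ => ρ ^ (x.1 + x.2)) := by
  have := (summable_geometric_of_lt_one h0 h1).mul_of_nonneg (summable_geometric_of_lt_one h0 h1)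
    (fun _ => by positivity) (fun _ => by positivity)
  simpa [pow_add] using this

theorem cc_summable {l : ℝ} (h0 : 0 ≤ l) (h1 : l ≤ 1) {X : ℝ} (hX : 0 ≤ X) (hX1 : X < 1) :
    Summable (fun k => cc l k * X ^ k) := by
  refine Summable.of_nonneg_of_le (fun k => ?_) (fun k => ?_) (summable_geometric_of_lt_one hX hX1)
  · exact mul_nonneg (cc_nonneg h0 k) (by positivity)
  · exact mul_le_of_le_one_left (by positivity) (cc_le_one h0 h1 k)

theorem binom_prod_hasSum (X Y : ℝ) (i j : ℕ) :
    HasSum (fun y : ℕ × ℕ => ((i.choose y.2 : ℝ) * Y ^ y.2) * ((j.choose y.1 : ℝ) * X ^ y.1))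
      ((1 + Y) ^ i * (1 + X) ^ j) := by
  have h := hasSum_sum_of_ne_finset_zero (L := SummationFilter.unconditional _) (s := Finset.range (j + 1) ×ˢ Finset.range (i + 1))
    (f := fun y : ℕ × ℕ => ((i.choose y.2 : ℝ) * Y ^ y.2) * ((j.choose y.1 : ℝ) * X ^ y.1)) (by
      rintro ⟨q, p⟩ h
      simp only [Finset.mem_product, Finset.mem_range, not_and_or, not_lt] at h
      rcases h with h | h
      · simp [Nat.choose_eq_zero_of_lt (show j < q by omega)]
      · simp [Nat.choose_eq_zero_of_lt (show i < p by omega)])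
  refine hs_congr h (fun _ => rfl) ?_
  rw [Finset.sum_product_right]
  simp_rw [← Finset.mul_sum]
  rw [← Finset.sum_mul, add_comm 1 Y, add_comm 1 X, add_pow, add_pow]
  congr 1 <;> exact Finset.sum_congr rfl (fun _ _ => by ring)

theorem bailey_near {l : ℝ} (h0 : 0 ≤ l) (h1 : l ≤ 1) {θ X Y : ℝ} (hθ : 0 < θ) (hθ' : θ < 1)
    (hX : 0 ≤ X) (hY : 0 ≤ Y) (hX1 : X < 1) (hY1 : Y < 1)
    (h : X * (1 + Y) / θ + Y * (1 + X) / (1 - θ) < 1) :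
    ∑' x : ℕ × ℕ, dd l x * ((X * (1 - Y)) ^ x.1 * (Y * (1 - X)) ^ x.2)
      = (∑' k, cc l k * X ^ k) * ∑' k, cc l k * Y ^ k := by
  let H : (ℕ × ℕ) × (ℕ × ℕ) → ℝ := fun z =>
    dd l z.1 * (X ^ z.1.1 * Y ^ z.1.2) *
      (((z.1.1.choose z.2.2 : ℝ) * (-Y) ^ z.2.2) * ((z.1.2.choose z.2.1 : ℝ) * (-X) ^ z.2.1))
  have hb : 0 < 1 - θ := by linarith
  have hHs : Summable H := by
    rw [← summable_abs_iff]
    have habs : ∀ z, |H z| = dd l z.1 * (X ^ z.1.1 * Y ^ z.1.2) *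
      (((z.1.1.choose z.2.2 : ℝ) * Y ^ z.2.2) * ((z.1.2.choose z.2.1 : ℝ) * X ^ z.2.1)) := by
      intro z
      simp only [H, abs_mul, abs_pow, abs_neg, abs_of_nonneg hX, abs_of_nonneg hY,
        abs_of_nonneg (dd_nonneg h0 z.1), Nat.abs_cast]
    simp_rw [habs]
    have hfib : ∀ x : ℕ × ℕ, HasSum (fun y : ℕ × ℕ => dd l x * (X ^ x.1 * Y ^ x.2) *
      (((x.1.choose y.2 : ℝ) * Y ^ y.2) * ((x.2.choose y.1 : ℝ) * X ^ y.1)))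
      (dd l x * (X ^ x.1 * Y ^ x.2) * ((1 + Y) ^ x.1 * (1 + X) ^ x.2)) := fun x =>
      (binom_prod_hasSum X Y x.1 x.2).mul_left _
    rw [summable_prod_of_nonneg]
    · refine ⟨fun x => (hfib x).summable, ?_⟩
      simp_rw [fun x => (hfib x).tsum_eq]
      refine Summable.of_nonneg_of_le (fun x => ?_) (fun x => ?_) (summable_pow_add ?_ h)
      · exact mul_nonneg (mul_nonneg (dd_nonneg h0 x) (by positivity)) (by positivity)
      · have := dd_bound h0 h1 hθ hθ' (A := X * (1 + Y)) (B := Y * (1 + X)) (by positivity)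
          (by positivity) x
        refine le_trans (le_of_eq ?_) this
        rw [mul_pow, mul_pow]; ring
      · positivity
    · intro z
      exact mul_nonneg (mul_nonneg (dd_nonneg h0 _) (by positivity)) (by positivity)
  have hH := hHs.hasSum
  have s1 := hH.prod_fiberwise (fun x => (binom_prod_hasSum (-X) (-Y) x.1 x.2).mul_left
    (dd l x * (X ^ x.1 * Y ^ x.2)))
  have t1 : ∑' x : ℕ × ℕ, dd l x * ((X * (1 - Y)) ^ x.1 * (Y * (1 - X)) ^ x.2) = ∑' z, H z := by
    rw [← s1.tsum_eq]
    refine tsum_congr (fun x => ?_)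
    rw [mul_pow, mul_pow]; ring
  have s2 := hH.tsum_fiberwise (fun z : (ℕ × ℕ) × (ℕ × ℕ) => (z.1.1 + z.2.1, z.1.2 + z.2.2))
  have s3 := (cc_summable h0 h1 hX hX1).hasSum.mul (cc_summable h0 h1 hY hY1).hasSum
    ((cc_summable h0 h1 hX hX1).mul_of_nonneg (cc_summable h0 h1 hY hY1)
    (fun k => mul_nonneg (cc_nonneg h0 k) (by positivity))
    (fun k => mul_nonneg (cc_nonneg h0 k) (by positivity)))
  rw [t1]
  refine s2.unique (hs_congr s3 (fun mn => ?_) rfl)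
  obtain ⟨m, n⟩ := mn
  let e := Equiv.prodProdProdComm ℕ ℕ ℕ ℕ
  have hset : ((fun z : (ℕ × ℕ) × (ℕ × ℕ) => (z.1.1 + z.2.1, z.1.2 + z.2.2)) ⁻¹' {(m, n)})
    = (((Finset.HasAntidiagonal.antidiagonal m ×ˢ Finset.HasAntidiagonal.antidiagonal n).map
      e.toEmbedding : Finset ((ℕ × ℕ) × (ℕ × ℕ))) : Set ((ℕ × ℕ) × (ℕ × ℕ))) := by
    ext ⟨⟨i, j⟩, ⟨q, p⟩⟩
    simp [e, Equiv.prodProdProdComm]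
  rw [hset, Finset.tsum_subtype', Finset.sum_map, Finset.sum_product,
    show cc l m * X ^ m * (cc l n * Y ^ n) = (cc l m * cc l n) * (X ^ m * Y ^ n) by ring,
    ← fiber_sum, Finset.sum_mul]
  refine Finset.sum_congr rfl (fun x hx => ?_)
  rw [Finset.sum_mul]
  refine Finset.sum_congr rfl (fun y hy => ?_)
  rw [Finset.HasAntidiagonal.mem_antidiagonal] at hx hy
  simp only [H, e, Equiv.prodProdProdComm, Equiv.coe_toEmbedding, Equiv.coe_fn_mk, dd]
  rw [← hx, ← hy, neg_pow X, neg_pow Y]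
  ring

theorem freq_ofReal {P : ℂ → Prop} {x0 : ℝ} (h : ∀ᶠ t : ℝ in 𝓝[>] x0, P (t : ℂ)) :
    ∃ᶠ z in 𝓝[≠] (x0 : ℂ), P z := by
  have ht : Tendsto (fun t : ℝ => (t : ℂ)) (𝓝[>] x0) (𝓝[≠] (x0 : ℂ)) := by
    apply tendsto_nhdsWithin_iff.2
    refine ⟨(Complex.continuous_ofReal.tendsto x0).mono_left nhdsWithin_le_nhds, ?_⟩
    filter_upwards [self_mem_nhdsWithin] with t ht
    simp only [mem_compl_iff, mem_singleton_iff, Complex.ofReal_inj]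
    exact ne_of_gt ht
  exact ht.frequently h.frequently

theorem bailey_int {l : ℝ} (h0 : 0 ≤ l) (h1 : l ≤ 1) {X Y : ℝ}
    (hX : 0 < X) (hY : 0 < Y) (hXY : X + Y < 1) :
    HasSum (fun x : ℕ × ℕ => dd l x * ((X * (1 - Y)) ^ x.1 * (Y * (1 - X)) ^ x.2))
      ((∑' k, cc l k * X ^ k) * ∑' k, cc l k * Y ^ k) := by
  obtain ⟨θ, hθd⟩ : ∃ θ, θ = (X + 1 - Y) / 2 := ⟨_, rfl⟩
  have hθ : 0 < θ := by linarith
  have hθ' : 0 < 1 - θ := by linarith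
  have hY1 : 0 < 1 - Y := by linarith
  have b1 : X * (1 - Y) / θ + Y * (1 - X) / (1 - θ) < 1 := by
    rw [div_add_div _ _ hθ.ne' hθ'.ne', div_lt_one (by positivity)]
    have : 0 < (θ - X) * (1 - Y - θ) := mul_pos (by linarith) (by linarith)
    nlinarith
  have b2 : Y / (1 - θ) < 1 := by rw [div_lt_one hθ']; linarith
  obtain ⟨ρ, hρ0, hρ1, c1, c2⟩ : ∃ ρ, 0 < ρ ∧ ρ < 1 ∧ X * (1 - Y) / θ + Y * (1 - X) / (1 - θ) < ρ ∧
      Y / (1 - θ) < ρ := by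
    obtain ⟨ρ, h1, h2⟩ := exists_between (max_lt b1 b2)
    exact ⟨ρ, lt_of_le_of_lt (by positivity) (lt_of_le_of_lt (le_max_right _ _) h1), h2, lt_of_le_of_lt (le_max_left _ _) h1,
      lt_of_le_of_lt (le_max_right _ _) h1⟩
  let gg : ℂ → ℝ := fun z => (1 - Y) / θ * ‖z‖ + Y / (1 - θ) * dist z 1
  let Ω : Set ℂ := {z | gg z < ρ}
  have hgc : Continuous gg := by fun_prop
  have hΩo : IsOpen Ω := isOpen_lt hgc continuous_const
  have hgconv : ConvexOn ℝ univ gg :=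
    ((convexOn_norm convex_univ).smul (by positivity)).add
      ((convexOn_dist (1 : ℂ) convex_univ).smul (by positivity))
  have hΩc : IsPreconnected Ω := by
    have := (hgconv.convex_lt ρ).isPreconnected
    simpa [Ω] using this
  have m0 : ((0 : ℝ) : ℂ) ∈ Ω := by simp [Ω, gg, c2]
  have mX : (X : ℂ) ∈ Ω := by
    have : dist (X : ℂ) 1 = 1 - X := by
      rw [Complex.dist_eq, ← Complex.ofReal_one, ← Complex.ofReal_sub, Complex.norm_real,
        Real.norm_eq_abs, abs_of_neg (by linarith)]; ring
    simp only [Ω, gg, mem_ofPred_eq, this, Complex.norm_real, Real.norm_eq_abs, abs_of_pos hX]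
    refine lt_of_eq_of_lt ?_ c1; ring
  let f : ℂ → ℂ := fun z => ∑' x : ℕ × ℕ, (dd l x : ℂ) * ((z * ((1 - Y : ℝ) : ℂ)) ^ x.1 * ((Y : ℂ) * (1 - z)) ^ x.2)
  let g : ℂ → ℂ := fun z => (∑' k, ((cc l k : ℝ) : ℂ) * z ^ k) * ((∑' k, cc l k * Y ^ k : ℝ) : ℂ)
  have hterm : ∀ (x : ℕ × ℕ) (z : ℂ), z ∈ Ω →
      ‖(dd l x : ℂ) * ((z * ((1 - Y : ℝ) : ℂ)) ^ x.1 * ((Y : ℂ) * (1 - z)) ^ x.2)‖ ≤ ρ ^ (x.1 + x.2) := by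
    intro x z hz
    have := dd_bound h0 h1 hθ (by linarith) (A := ‖z‖ * (1 - Y)) (B := Y * dist z 1) (by positivity)
      (by positivity) x
    rw [norm_mul, norm_mul, norm_pow, norm_pow, norm_mul, norm_mul, Complex.norm_real, Complex.norm_real,
      Complex.norm_real, Real.norm_of_nonneg (dd_nonneg h0 x), Real.norm_of_nonneg hY.le,
      Real.norm_of_nonneg hY1.le, ← dist_eq_norm, dist_comm]
    refine this.trans ?_
    have h2 : gg z < ρ := hz
    have h3 : ‖z‖ * (1 - Y) / θ + Y * dist z 1 / (1 - θ) = gg z := by simp only [gg]; ring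
    rw [h3]
    exact pow_le_pow_left₀ (by simp only [gg]; positivity) h2.le _
  have hf : DifferentiableOn ℂ f Ω := by
    refine Complex.differentiableOn_tsum_of_summable_norm (summable_pow_add hρ0.le hρ1) (fun x => ?_) hΩo hterm
    exact Differentiable.differentiableOn (by fun_prop)
  have hnorm : ∀ z ∈ Ω, ‖z‖ < ρ := by
    intro z hz
    have h2 : gg z < ρ := hz
    have h3 : 0 ≤ Y / (1 - θ) * dist z 1 := by positivity
    have h4 : 1 ≤ (1 - Y) / θ := by rw [le_div_iff₀ hθ]; linarith
    have h5 : 0 ≤ ‖z‖ := norm_nonneg z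
    simp only [gg] at h2
    nlinarith
  have hg : DifferentiableOn ℂ g Ω := by
    apply DifferentiableOn.mul_const
    refine Complex.differentiableOn_tsum_of_summable_norm (summable_geometric_of_lt_one hρ0.le hρ1)
      (fun k => Differentiable.differentiableOn (by fun_prop)) hΩo (fun k z hz => ?_)
    rw [norm_mul, norm_pow, Complex.norm_real, Real.norm_of_nonneg (cc_nonneg h0 k)]
    refine (mul_le_of_le_one_left (by positivity) (cc_le_one h0 h1 k)).trans ?_
    exact pow_le_pow_left₀ (norm_nonneg z) (hnorm z hz).le _
  have hcast : ∀ t : ℝ, (∑' x : ℕ × ℕ, dd l x * ((t * (1 - Y)) ^ x.1 * (Y * (1 - t)) ^ x.2)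
      = (∑' k, cc l k * t ^ k) * ∑' k, cc l k * Y ^ k) ↔ f (t : ℂ) = g (t : ℂ) := by
    intro t
    have e1 : f (t : ℂ) = ((∑' x : ℕ × ℕ, dd l x * ((t * (1 - Y)) ^ x.1 * (Y * (1 - t)) ^ x.2) : ℝ) : ℂ) := by
      simp only [f]; push_cast; rfl
    have e2 : g (t : ℂ) = (((∑' k, cc l k * t ^ k) * ∑' k, cc l k * Y ^ k : ℝ) : ℂ) := by
      simp only [g]; push_cast; rfl
    rw [e1, e2, Complex.ofReal_inj]
  have hfreq : ∃ᶠ z in 𝓝[≠] ((0 : ℝ) : ℂ), f z = g z := by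
    apply freq_ofReal
    have hc : Continuous (fun t : ℝ => t * (1 + Y) / θ + Y * (1 + t) / (1 - θ)) := by fun_prop
    have e1 : ∀ᶠ t : ℝ in 𝓝[>] 0, t * (1 + Y) / θ + Y * (1 + t) / (1 - θ) < 1 :=
      nhdsWithin_le_nhds ((hc.tendsto 0).eventually (gt_mem_nhds (by simpa using b2)))
    have e2 : ∀ᶠ t : ℝ in 𝓝[>] 0, t < 1 := nhdsWithin_le_nhds (gt_mem_nhds one_pos)
    filter_upwards [e1, e2, self_mem_nhdsWithin] with t h1' h2' h3'
    rw [← hcast]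
    exact bailey_near h0 h1 hθ (by linarith) (le_of_lt h3') hY.le h2' (by linarith) h1'
  have key := (hf.analyticOnNhd hΩo).eqOn_of_preconnected_of_frequently_eq (hg.analyticOnNhd hΩo) hΩc m0 hfreq mX
  rw [← (hcast X).2 key]
  apply Summable.hasSum
  refine Summable.of_norm_bounded (summable_pow_add hρ0.le hρ1) (fun x => ?_)
  have := hterm x X mX
  have e : (dd l x : ℂ) * (((X : ℂ) * ((1 - Y : ℝ) : ℂ)) ^ x.1 * ((Y : ℂ) * (1 - (X : ℂ))) ^ x.2)
    = ((dd l x * ((X * (1 - Y)) ^ x.1 * (Y * (1 - X)) ^ x.2) : ℝ) : ℂ) := by push_cast; rfl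
  rw [e, Complex.norm_real] at this
  exact this

theorem F_cont {l : ℝ} (h0 : 0 ≤ l) (h1 : l ≤ 1) {X : ℝ} (hX : 0 < X) (hX1 : X < 1) :
    ContinuousAt (fun X => ∑' k, cc l k * X ^ k) X := by
  obtain ⟨r, hr, hr1⟩ := exists_between hX1
  have : ContinuousOn (fun X => ∑' k, cc l k * X ^ k) (Icc 0 r) := by
    refine continuousOn_tsum (fun k => by fun_prop) (summable_geometric_of_lt_one (hX.le.trans hr.le) hr1)
      (fun k x hx => ?_)
    rw [Real.norm_of_nonneg (mul_nonneg (cc_nonneg h0 k) (pow_nonneg hx.1 k))]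
    exact (mul_le_of_le_one_left (pow_nonneg hx.1 k) (cc_le_one h0 h1 k)).trans
      (pow_le_pow_left₀ hx.1 hx.2 k)
  exact this.continuousAt (Icc_mem_nhds hX hr)

theorem bailey {l : ℝ} (h0 : 0 ≤ l) (h1 : l ≤ 1) {X Y : ℝ}
    (hX : 0 < X) (hY : 0 < Y) (hXY : X + Y = 1) :
    HasSum (fun x : ℕ × ℕ => dd l x * ((X ^ 2) ^ x.1 * (Y ^ 2) ^ x.2))
      ((∑' k, cc l k * X ^ k) * ∑' k, cc l k * Y ^ k) := by
  have hY1 : 1 - Y = X := by linarith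
  have hX1 : 1 - X = Y := by linarith
  have hlim : Tendsto (fun δ : ℝ => (∑' k, cc l k * (X - δ) ^ k) * ∑' k, cc l k * (Y - δ) ^ k) (𝓝[>] 0)
      (𝓝 ((∑' k, cc l k * X ^ k) * ∑' k, cc l k * Y ^ k)) := by
    apply Tendsto.mono_left _ nhdsWithin_le_nhds
    have t1 : Tendsto (fun δ : ℝ => X - δ) (𝓝 0) (𝓝 X) := by
      simpa using (tendsto_const_nhds (x := X)).sub (tendsto_id (α := ℝ) (x := 𝓝 0))
    have t2 : Tendsto (fun δ : ℝ => Y - δ) (𝓝 0) (𝓝 Y) := by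
      simpa using (tendsto_const_nhds (x := Y)).sub (tendsto_id (α := ℝ) (x := 𝓝 0))
    exact ((F_cont h0 h1 hX (by linarith)).tendsto.comp t1).mul ((F_cont h0 h1 hY (by linarith)).tendsto.comp t2)
  have hev : ∀ᶠ δ : ℝ in 𝓝[>] 0, 0 < δ ∧ δ < X ∧ δ < Y := by
    filter_upwards [self_mem_nhdsWithin, nhdsWithin_le_nhds (gt_mem_nhds hX), nhdsWithin_le_nhds (gt_mem_nhds hY)]
      with δ a b c using ⟨a, b, c⟩
  have hint : ∀ δ : ℝ, 0 < δ → δ < X → δ < Y → HasSum (fun x : ℕ × ℕ => dd l x *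
      (((X - δ) * (X + δ)) ^ x.1 * ((Y - δ) * (Y + δ)) ^ x.2))
      ((∑' k, cc l k * (X - δ) ^ k) * ∑' k, cc l k * (Y - δ) ^ k) := by
    intro δ a b c
    have := bailey_int h0 h1 (X := X - δ) (Y := Y - δ) (by linarith) (by linarith) (by linarith)
    rw [show 1 - (Y - δ) = X + δ by linarith, show 1 - (X - δ) = Y + δ by linarith] at this
    exact this
  have hnn : ∀ x : ℕ × ℕ, 0 ≤ dd l x * ((X ^ 2) ^ x.1 * (Y ^ 2) ^ x.2) := fun x =>
    mul_nonneg (dd_nonneg h0 x) (by positivity)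
  have hpart : ∀ s : Finset (ℕ × ℕ), ∑ x ∈ s, dd l x * ((X ^ 2) ^ x.1 * (Y ^ 2) ^ x.2) ≤
      (∑' k, cc l k * X ^ k) * ∑' k, cc l k * Y ^ k := by
    intro s
    have hc : Continuous (fun δ : ℝ => ∑ x ∈ s, dd l x *
      (((X - δ) * (X + δ)) ^ x.1 * ((Y - δ) * (Y + δ)) ^ x.2)) := by fun_prop
    have ht := (hc.tendsto 0).mono_left (nhdsWithin_le_nhds (s := Ioi 0))
    simp only [sub_zero, add_zero, ← sq] at ht
    refine le_of_tendsto_of_tendsto ht hlim ?_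
    filter_upwards [hev] with δ ⟨a, b, c⟩
    refine sum_le_hasSum s (fun x _ => mul_nonneg (dd_nonneg h0 x) ?_) (hint δ a b c)
    have : 0 < X - δ := by linarith
    have : 0 < Y - δ := by linarith
    positivity
  have hs : Summable (fun x : ℕ × ℕ => dd l x * ((X ^ 2) ^ x.1 * (Y ^ 2) ^ x.2)) :=
    summable_of_sum_le hnn hpart
  have hle : ∑' x : ℕ × ℕ, dd l x * ((X ^ 2) ^ x.1 * (Y ^ 2) ^ x.2) ≤
      (∑' k, cc l k * X ^ k) * ∑' k, cc l k * Y ^ k := hs.tsum_le_of_sum_le hpart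
  have hge : (∑' k, cc l k * X ^ k) * (∑' k, cc l k * Y ^ k) ≤
      ∑' x : ℕ × ℕ, dd l x * ((X ^ 2) ^ x.1 * (Y ^ 2) ^ x.2) := by
    refine le_of_tendsto hlim ?_
    filter_upwards [hev] with δ ⟨a, b, c⟩
    refine hasSum_le (fun x => ?_) (hint δ a b c) hs.hasSum
    have p1 : 0 ≤ (X - δ) * (X + δ) := mul_nonneg (by linarith) (by linarith)
    have p2 : 0 ≤ (Y - δ) * (Y + δ) := mul_nonneg (by linarith) (by linarith)
    have q1 : (X - δ) * (X + δ) ≤ X ^ 2 := by nlinarith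
    have q2 : (Y - δ) * (Y + δ) ≤ Y ^ 2 := by nlinarith
    have := dd_nonneg h0 x
    gcongr
  rw [le_antisymm hge hle]
  exact hs.hasSum

theorem bailey_k {l : ℝ} (h0 : 0 ≤ l) (h1 : l ≤ 1) {X Y : ℝ}
    (hX : 0 < X) (hY : 0 < Y) (hXY : X + Y = 1) :
    HasSum (fun k : ℕ => cc l k * ∑ j ∈ Finset.range (k + 1), (k.choose j : ℝ) * ((-1) ^ j * (2 * j).choose j * (X * Y) ^ j))
      ((∑' k, cc l k * X ^ k) * ∑' k, cc l k * Y ^ k) := by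
  have h := (Finset.HasAntidiagonal.sigmaAntidiagonalEquivProd.hasSum_iff.2 (bailey h0 h1 hX hY hXY)).sigma
    (fun k => hasSum_fintype _)
  refine hs_congr h (fun k => ?_) rfl
  rw [← pk_identity X Y hXY, Finset.mul_sum]
  rw [← Finset.sum_coe_sort]
  refine Finset.sum_congr rfl (fun x _ => ?_)
  have hx := x.2
  rw [Finset.HasAntidiagonal.mem_antidiagonal] at hx
  simp only [Function.comp, Finset.HasAntidiagonal.sigmaAntidiagonalEquivProd, Equiv.coe_fn_mk, dd, hx]
  ring

/-- Taylor coefficients at the midpoint -/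
noncomputable def an (l : ℝ) (n : ℕ) : ℝ := ∑' k : ℕ, cc l k * (1 / 2) ^ k * (k.choose n : ℝ)

theorem an_hasSum {l : ℝ} (h0 : 0 ≤ l) (h1 : l ≤ 1) {x : ℝ} (hx : |x| < 1) :
    HasSum (fun n => an l n * x ^ n) (∑' k, cc l k * ((1 + x) / 2) ^ k) := by
  let G : ℕ × ℕ → ℝ := fun z => cc l z.1 * (1 / 2) ^ z.1 * ((z.1.choose z.2 : ℝ) * x ^ z.2)
  have hb : ∀ (y : ℝ) (k : ℕ), HasSum (fun n : ℕ => (k.choose n : ℝ) * y ^ n) ((1 + y) ^ k) := by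
    intro y k
    have h := hasSum_sum_of_ne_finset_zero (L := SummationFilter.unconditional _) (s := Finset.range (k + 1))
      (f := fun n : ℕ => (k.choose n : ℝ) * y ^ n) (by
        intro n h
        simp [Nat.choose_eq_zero_of_lt (show k < n by simpa using h)])
    refine hs_congr h (fun _ => rfl) ?_
    rw [add_comm, add_pow]
    exact Finset.sum_congr rfl (fun _ _ => by ring)
  have hG : Summable G := by
    rw [← summable_abs_iff]
    have habs : ∀ z, |G z| = cc l z.1 * (1 / 2) ^ z.1 * ((z.1.choose z.2 : ℝ) * |x| ^ z.2) := by
      intro z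
      simp only [G, abs_mul, abs_pow, abs_of_nonneg (cc_nonneg h0 z.1), Nat.abs_cast,
        abs_of_pos (show (0 : ℝ) < 1 / 2 by norm_num)]
    simp_rw [habs]
    have hfib := fun k : ℕ => (hb |x| k).mul_left (cc l k * (1 / 2) ^ k)
    rw [summable_prod_of_nonneg]
    · refine ⟨fun k => (hfib k).summable, ?_⟩
      simp_rw [fun k => (hfib k).tsum_eq]
      refine (cc_summable h0 h1 (X := (1 + |x|) / 2) (by positivity) (by linarith)).congr (fun k => ?_)
      rw [mul_assoc, ← mul_pow]; congr 2; ring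
    · intro z
      exact mul_nonneg (mul_nonneg (cc_nonneg h0 _) (by positivity)) (by positivity)
  have s1 := hG.hasSum.prod_fiberwise (fun k => (hb x k).mul_left (cc l k * (1 / 2) ^ k))
  have hG2 : Summable (G ∘ Equiv.prodComm ℕ ℕ) := (Equiv.prodComm ℕ ℕ).summable_iff.2 hG
  have hG3 : HasSum (G ∘ Equiv.prodComm ℕ ℕ) (∑' z, G z) := (Equiv.prodComm ℕ ℕ).hasSum_iff.2 hG.hasSum
  have s2 := hG3.prod_fiberwise (fun n => (hG2.prod_factor n).hasSum)
  refine hs_congr s2 (fun n => ?_) ?_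
  · rw [an, ← tsum_mul_right]
    refine tsum_congr (fun k => ?_)
    simp [G]; ring
  · rw [← s1.tsum_eq]
    refine tsum_congr (fun k => ?_)
    rw [mul_assoc, ← mul_pow]; congr 2; ring

theorem an_summable_aux {l : ℝ} (h0 : 0 ≤ l) (h1 : l ≤ 1) (n d : ℕ) :
    Summable (fun k : ℕ => (k : ℝ) ^ d * (cc l k * (1 / 2) ^ k * (k.choose n : ℝ))) := by
  have := summable_pow_mul_geometric_of_norm_lt_one (R := ℝ) (d + n) (r := 1 / 2) (by norm_num)
  refine Summable.of_nonneg_of_le (fun k => ?_) (fun k => ?_) this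
  · have := cc_nonneg h0 k
    positivity
  · have e1 : (k.choose n : ℝ) ≤ (k : ℝ) ^ n := by exact_mod_cast Nat.choose_le_pow k n
    have e2 := cc_le_one h0 h1 k
    have e3 := cc_nonneg h0 k
    calc (k : ℝ) ^ d * (cc l k * (1 / 2) ^ k * (k.choose n : ℝ))
        ≤ (k : ℝ) ^ d * (1 * (1 / 2) ^ k * (k : ℝ) ^ n) := by gcongr
      _ = _ := by rw [pow_add]; ring

theorem an_rec {l : ℝ} (h0 : 0 ≤ l) (h1 : l ≤ 1) (n : ℕ) :
    ((n : ℝ) + 1) * (n + 2) * an l (n + 2) = ((n : ℝ) * (n + 1) + l) * an l n := by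
  let b : ℕ → ℝ := fun k => cc l k * (1 / 2) ^ k * (k.choose n : ℝ)
  let T : ℕ → ℝ := fun k => -2 * k * (k - n) * b k
  have sb : Summable b := by simpa [b] using an_summable_aux h0 h1 n 0
  have sb1 : Summable (fun k : ℕ => (k : ℝ) * b k) := by simpa [b] using an_summable_aux h0 h1 n 1
  have sb2 : Summable (fun k : ℕ => (k : ℝ) ^ 2 * b k) := an_summable_aux h0 h1 n 2
  have sc : Summable (fun k => cc l k * (1 / 2) ^ k * (k.choose (n + 2) : ℝ)) := by
    simpa using an_summable_aux h0 h1 (n + 2) 0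
  have sT : Summable T := by
    have := (sb2.mul_left (-2 : ℝ)).add (sb1.mul_left (2 * (n : ℝ)))
    refine this.congr (fun k => ?_)
    simp only [T]; ring
  have hT0 := sT.tendsto_atTop_zero
  have hstep : ∀ k, T (k + 1) - T k = ((k : ℝ) ^ 2 - 2 * k * n - k - l) * b k := by
    intro k
    have e1 : ((k : ℝ) + 1 - n) * ((k + 1).choose n : ℝ) = (k + 1) * (k.choose n : ℝ) := by
      rcases Nat.lt_or_ge (k + 1) n with h | h
      · rw [Nat.choose_eq_zero_of_lt h, Nat.choose_eq_zero_of_lt (show k < n by omega)]; simp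
      · have := congrArg (fun x : ℕ => (x : ℝ)) (Nat.choose_mul_succ_eq k n)
        push_cast [h] at this; linarith
    have e2 := cc_succ l k
    simp only [T, b]
    push_cast
    rw [pow_succ]
    linear_combination (-(k + 1) * cc l (k + 1) * (1 / 2) ^ k) * e1 - ((1 / 2) ^ k * (k.choose n : ℝ)) * e2
  have hterm : ∀ k : ℕ, ((n : ℝ) + 1) * (n + 2) * (cc l k * (1 / 2) ^ k * (k.choose (n + 2) : ℝ)) -
      ((n : ℝ) * (n + 1) + l) * b k = T (k + 1) - T k := by
    intro k
    rw [hstep]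
    have e1 : ∀ m : ℕ, (k.choose (m + 1) : ℝ) * (m + 1) = k.choose m * (k - m) := by
      intro m
      rcases Nat.lt_or_ge k m with h | h
      · rw [Nat.choose_eq_zero_of_lt h, Nat.choose_eq_zero_of_lt (show k < m + 1 by omega)]; simp
      · have := congrArg (fun x : ℕ => (x : ℝ)) (Nat.choose_succ_right_eq k m)
        push_cast [h] at this; exact this
    have e2 := e1 n
    have e3 := e1 (n + 1)
    push_cast at e3
    simp only [b]
    linear_combination (cc l k * (1 / 2) ^ k) * ((n + 1) * e3 + (k - (n + 1)) * e2)
  have hs := (sc.mul_left (((n : ℝ) + 1) * (n + 2))).sub (sb.mul_left ((n : ℝ) * (n + 1) + l))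
  have hlim := hs.hasSum.tendsto_sum_nat
  have hlim2 : Tendsto (fun N => ∑ k ∈ Finset.range N, (((n : ℝ) + 1) * (n + 2) *
      (cc l k * (1 / 2) ^ k * (k.choose (n + 2) : ℝ)) - ((n : ℝ) * (n + 1) + l) * b k)) atTop (𝓝 0) := by
    refine hT0.congr (fun N => ?_)
    rw [Finset.sum_congr rfl (fun k _ => hterm k), Finset.sum_range_sub]
    simp [T]
  have h00 := tendsto_nhds_unique hlim hlim2
  rw [Summable.tsum_sub (sc.mul_left _) (sb.mul_left _), tsum_mul_left, tsum_mul_left] at h00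
  have : an l (n + 2) = ∑' k, cc l k * (1 / 2) ^ k * (k.choose (n + 2) : ℝ) := rfl
  have h3 : an l n = ∑' k, b k := rfl
  rw [this, h3]; linarith

theorem even_hasSum {l : ℝ} (h0 : 0 ≤ l) (h1 : l ≤ 1) {x : ℝ} (hx : |x| < 1) :
    HasSum (fun n => an l (2 * n) * x ^ (2 * n))
      (((∑' k, cc l k * ((1 + x) / 2) ^ k) + ∑' k, cc l k * ((1 - x) / 2) ^ k) / 2) := by
  have hx' : |-x| < 1 := by rwa [abs_neg]
  have h := ((an_hasSum h0 h1 hx).add (an_hasSum h0 h1 hx')).div_const 2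
  have hi : Function.Injective (fun n : ℕ => 2 * n) := fun a b h => by simpa using h
  have h2 := (hi.hasSum_iff (by
    intro n hn
    have : Odd n := by
      rw [← Nat.not_even_iff_odd]
      rintro ⟨r, hr⟩
      exact hn ⟨r, by simp; omega⟩
    rw [this.neg_pow]; ring)).2 h
  refine hs_congr h2 (fun n => ?_) ?_
  · simp only [Function.comp]
    rw [(even_two_mul n).neg_pow]; ring
  · rw [sub_eq_add_neg]

theorem an_even {a : ℝ} (ha : 0 < a) (ha' : a < 1 / 2) (n : ℕ) :
    an (2 * a * (1 - 2 * a)) (2 * n) = an (2 * a * (1 - 2 * a)) 0 * √Real.pi /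
      (Real.Gamma (1 / 2 - a) * Real.Gamma a) *
      (Real.Gamma (1 / 2 - a + n) * Real.Gamma (a + n) / (n.factorial * Real.Gamma (1 / 2 + n))) := by
  have hl0 : 0 ≤ 2 * a * (1 - 2 * a) := mul_nonneg (by linarith) (by linarith)
  have hl1 : 2 * a * (1 - 2 * a) ≤ 1 := by nlinarith
  have hg1 : Real.Gamma (1 / 2 - a) ≠ 0 := (Real.Gamma_pos_of_pos (by linarith)).ne'
  have hg2 : Real.Gamma a ≠ 0 := (Real.Gamma_pos_of_pos ha).ne'
  have hpi : √Real.pi ≠ 0 := (Real.sqrt_pos.2 Real.pi_pos).ne'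
  induction n with
  | zero =>
    simp only [mul_zero, Nat.cast_zero, add_zero, Nat.factorial_zero, Nat.cast_one, one_mul,
      Real.Gamma_one_half_eq]
    generalize Real.Gamma (1 / 2 - a) = g at *
    field_simp
  | succ n ih =>
    have h := an_rec hl0 hl1 (2 * n)
    rw [ih] at h
    push_cast at h
    have p : (0 : ℝ) ≤ n := Nat.cast_nonneg n
    have e1 : Real.Gamma (1 / 2 - a + (n + 1 : ℕ)) = (1 / 2 - a + n) * Real.Gamma (1 / 2 - a + n) := by
      rw [← Real.Gamma_add_one (by linarith)]; congr 1; push_cast; ring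
    have e2 : Real.Gamma (a + (n + 1 : ℕ)) = (a + n) * Real.Gamma (a + n) := by
      rw [← Real.Gamma_add_one (by linarith)]; congr 1; push_cast; ring
    have e3 : Real.Gamma (1 / 2 + (n + 1 : ℕ)) = (1 / 2 + n) * Real.Gamma (1 / 2 + n) := by
      rw [← Real.Gamma_add_one (by linarith)]; congr 1; push_cast; ring
    have g3 : Real.Gamma (1 / 2 + n) ≠ 0 := (Real.Gamma_pos_of_pos (by linarith)).ne'
    have f3 : (n.factorial : ℝ) ≠ 0 := by positivity
    rw [e1, e2, e3, Nat.factorial_succ, show 2 * (n + 1) = 2 * n + 2 by ring]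
    have p1 : (2 * (n : ℝ) + 1) * (2 * n + 2) ≠ 0 := by positivity
    have p2 : (1 / 2 + (n : ℝ)) ≠ 0 := by positivity
    have p3 : ((n : ℝ) + 1) ≠ 0 := by positivity
    apply mul_left_cancel₀ p1
    rw [h]
    push_cast
    field_simp
    ring

/-- the hypergeometric series -/
noncomputable def FF (a X : ℝ) : ℝ := ∑' k, cc (2 * a * (1 - 2 * a)) k * X ^ k

/-- even part -/
noncomputable def EE (a x : ℝ) : ℝ := (FF a ((1 + x) / 2) + FF a ((1 - x) / 2)) / 2

theorem sq_image : (fun x : ℝ => x ^ 2) '' Ioo 0 1 = Ioo 0 1 := by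
  ext y
  constructor
  · rintro ⟨x, ⟨h0, h1⟩, rfl⟩
    exact ⟨by positivity, by show x ^ 2 < 1; nlinarith⟩
  · rintro ⟨h0, h1⟩
    exact ⟨√y, ⟨Real.sqrt_pos.2 h0, by rw [Real.sqrt_lt' one_pos]; simpa using h1⟩, Real.sq_sqrt h0.le⟩

theorem beta2 {σ : ℝ} (hσ : 0 < σ) (n : ℕ) :
    IntegrableOn (fun x : ℝ => x ^ (2 * n) * (1 - x ^ 2) ^ (σ - 1)) (Ioo 0 1) ∧
    ∫ x in Ioo (0:ℝ) 1, x ^ (2 * n) * (1 - x ^ 2) ^ (σ - 1)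
      = 1 / 2 * (Real.Gamma (1 / 2 + n) * Real.Gamma σ / Real.Gamma (1 / 2 + n + σ)) := by
  obtain ⟨b1, b2⟩ := beta_int (u := 1 / 2 + n) (v := σ) (by positivity) hσ
  have hd : ∀ x ∈ Ioo (0:ℝ) 1, HasDerivWithinAt (fun x : ℝ => x ^ 2) (2 * x) (Ioo 0 1) x := by
    intro x _
    simpa using (hasDerivAt_pow 2 x).hasDerivWithinAt
  have hinj : InjOn (fun x : ℝ => x ^ 2) (Ioo 0 1) := by
    intro x hx y hy h
    exact (pow_left_inj₀ hx.1.le hy.1.le two_ne_zero).1 h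
  have hpt : ∀ x ∈ Ioo (0:ℝ) 1, 1 / 2 * (|2 * x| • ((x ^ 2) ^ ((1 / 2 + n : ℝ) - 1) * (1 - x ^ 2) ^ (σ - 1)))
      = x ^ (2 * n) * (1 - x ^ 2) ^ (σ - 1) := by
    intro x hx
    have h0 : 0 < x := hx.1
    have e1 : (x ^ 2) ^ ((1 / 2 + n : ℝ) - 1) * x = x ^ (2 * n) := by
      rw [← Real.rpow_natCast x 2, ← Real.rpow_mul h0.le, ← Real.rpow_add_one h0.ne', ← Real.rpow_natCast]
      congr 1; push_cast; ring
    rw [abs_of_pos (by linarith), smul_eq_mul, ← e1]; ring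
  have i1 := (integrableOn_image_iff_integrableOn_abs_deriv_smul measurableSet_Ioo hd hinj
    (fun x : ℝ => x ^ ((1 / 2 + n : ℝ) - 1) * (1 - x) ^ (σ - 1))).1 (by rw [sq_image]; exact b1)
  have i2 := integral_image_eq_integral_abs_deriv_smul measurableSet_Ioo hd hinj
    (fun x : ℝ => x ^ ((1 / 2 + n : ℝ) - 1) * (1 - x) ^ (σ - 1))
  rw [sq_image, b2] at i2
  constructor
  · exact IntegrableOn.congr_fun (i1.const_mul (1 / 2)) hpt measurableSet_Ioo
  · rw [i2, ← integral_const_mul]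
    exact (setIntegral_congr_fun measurableSet_Ioo hpt).symm

theorem ll0 {a : ℝ} (ha : 0 < a) (ha' : a < 1 / 2) : 0 ≤ 2 * a * (1 - 2 * a) :=
  mul_nonneg (by linarith) (by linarith)
theorem ll1 {a : ℝ} (_ha : 0 < a) (_ha' : a < 1 / 2) : 2 * a * (1 - 2 * a) ≤ 1 := by nlinarith

theorem an_zero (a : ℝ) : an (2 * a * (1 - 2 * a)) 0 = FF a (1 / 2) := by
  simp [an, FF]

theorem FF_one_le {a : ℝ} (ha : 0 < a) (ha' : a < 1 / 2) {X : ℝ} (h0 : 0 ≤ X) (h1 : X < 1) : 1 ≤ FF a X := by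
  have := (cc_summable (ll0 ha ha') (ll1 ha ha') h0 h1).le_tsum 0
    (fun k _ => mul_nonneg (cc_nonneg (ll0 ha ha') k) (by positivity))
  simp only [cc_zero, pow_zero, mul_one] at this
  exact this

theorem E_int {a : ℝ} (ha : 0 < a) (ha' : a < 1 / 2) {σ : ℝ} (hσ : 0 < σ) :
    IntegrableOn (fun x => EE a x * (1 - x ^ 2) ^ (σ - 1)) (Ioo 0 1) ∧
    ∫ x in Ioo (0:ℝ) 1, EE a x * (1 - x ^ 2) ^ (σ - 1) =
      1 / 2 * FF a (1 / 2) * √Real.pi * Real.Gamma σ ^ 2 / (Real.Gamma (σ + a) * Real.Gamma (σ + 1 / 2 - a)) := by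
  have hP : 0 < FF a (1 / 2) := lt_of_lt_of_le one_pos (FF_one_le ha ha' (by norm_num) (by norm_num))
  have G1 := Real.Gamma_pos_of_pos (show 0 < 1 / 2 - a by linarith)
  have G2 := Real.Gamma_pos_of_pos ha
  have G3 := Real.Gamma_pos_of_pos hσ
  have G4 := Real.Gamma_pos_of_pos (show 0 < σ + a by linarith)
  have G5 := Real.Gamma_pos_of_pos (show 0 < σ + 1 / 2 - a by linarith)
  have hpi : 0 < √Real.pi := Real.sqrt_pos.2 Real.pi_pos
  have hane : ∀ n, 0 ≤ an (2 * a * (1 - 2 * a)) (2 * n) := by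
    intro n
    refine tsum_nonneg (fun k => mul_nonneg (mul_nonneg (cc_nonneg (ll0 ha ha') k) (by positivity)) (by positivity))
  have key := T_v1 (s := Ioo (0:ℝ) 1)
    (f := fun n x => an (2 * a * (1 - 2 * a)) (2 * n) * (x ^ (2 * n) * (1 - x ^ 2) ^ (σ - 1)))
    (g := fun x => EE a x * (1 - x ^ 2) ^ (σ - 1))
    (V := 1 / 2 * FF a (1 / 2) * √Real.pi * Real.Gamma σ ^ 2 / (Real.Gamma (σ + a) * Real.Gamma (σ + 1 / 2 - a)))
    measurableSet_Ioo
    (fun n => (beta2 hσ n).1.const_mul _)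
    (fun n x hx => by
      have : 0 ≤ 1 - x ^ 2 := by nlinarith [hx.1, hx.2]
      exact mul_nonneg (hane n) (mul_nonneg (pow_nonneg hx.1.le _) (Real.rpow_nonneg this _)))
    (fun x hx => by
      have h := (even_hasSum (ll0 ha ha') (ll1 ha ha') (x := x) (by rw [abs_of_pos hx.1]; exact hx.2)).mul_right
        ((1 - x ^ 2) ^ (σ - 1))
      exact hs_congr h (fun n => by ring) rfl)
    (by
      have hg := (gauss (A := 1 / 2 - a) (B := a) (C := 1 / 2 + σ) (by linarith) ha (by linarith)).mul_left
        (1 / 2 * FF a (1 / 2) * √Real.pi * Real.Gamma σ / (Real.Gamma (1 / 2 - a) * Real.Gamma a))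
      refine hs_congr hg (fun n => ?_) ?_
      · rw [integral_const_mul, (beta2 hσ n).2, an_even ha ha', an_zero]
        have g1 := (Real.Gamma_pos_of_pos (show (0 : ℝ) < 1 / 2 + n by positivity)).ne'
        have g2 := (Real.Gamma_pos_of_pos (show (0 : ℝ) < 1 / 2 + n + σ by positivity)).ne'
        rw [show 1 / 2 + σ + (n : ℝ) = 1 / 2 + n + σ by ring]
        generalize Real.Gamma (1 / 2 - a) = x1 at *
        generalize Real.Gamma (1 / 2 + n + σ) = x2 at *
        generalize Real.Gamma (1 / 2 + n) = x3 at *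
        generalize Real.Gamma (1 / 2 - a + n) = x4 at *
        field_simp
      · rw [show 1 / 2 + σ - (1 / 2 - a) = σ + a by ring, show 1 / 2 + σ - a = σ + 1 / 2 - a by ring,
          show σ + a - a = σ by ring]
        generalize Real.Gamma (1 / 2 - a) = x1 at *
        generalize Real.Gamma (σ + 1 / 2 - a) = x2 at *
        field_simp)
  refine ⟨?_, key⟩
  by_contra hn
  have := integral_undef hn
  rw [this] at key
  have : 0 < 1 / 2 * FF a (1 / 2) * √Real.pi * Real.Gamma σ ^ 2 / (Real.Gamma (σ + a) * Real.Gamma (σ + 1 / 2 - a)) := by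
    positivity
  linarith

theorem cc_gamma {a : ℝ} (ha : 0 < a) (ha' : a < 1 / 2) (k : ℕ) :
    cc (2 * a * (1 - 2 * a)) k = Real.Gamma (1 - 2 * a + k) * Real.Gamma (2 * a + k) /
      ((k.factorial : ℝ) ^ 2 * (Real.Gamma (1 - 2 * a) * Real.Gamma (2 * a))) := by
  have G1 := Real.Gamma_pos_of_pos (show 0 < 1 - 2 * a by linarith)
  have G2 := Real.Gamma_pos_of_pos (show 0 < 2 * a by linarith)
  induction k with
  | zero => simp [cc_zero]; field_simp
  | succ k ih =>
    have p : (0 : ℝ) ≤ k := Nat.cast_nonneg k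
    have h := cc_succ (2 * a * (1 - 2 * a)) k
    have p1 : ((k : ℝ) + 1) ^ 2 ≠ 0 := by positivity
    have e1 : Real.Gamma (1 - 2 * a + (k + 1 : ℕ)) = (1 - 2 * a + k) * Real.Gamma (1 - 2 * a + k) := by
      rw [← Real.Gamma_add_one (by linarith)]; congr 1; push_cast; ring
    have e2 : Real.Gamma (2 * a + (k + 1 : ℕ)) = (2 * a + k) * Real.Gamma (2 * a + k) := by
      rw [← Real.Gamma_add_one (by linarith)]; congr 1; push_cast; ring
    apply mul_right_cancel₀ p1
    rw [h, ih, e1, e2, Nat.factorial_succ]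
    push_cast
    have f3 : (k.factorial : ℝ) ≠ 0 := by positivity
    field_simp
    ring

theorem E_int_one {a : ℝ} (ha : 0 < a) (ha' : a < 1 / 2) :
    ∫ x in Ioo (0:ℝ) 1, EE a x = 1 / (Real.Gamma (1 + 2 * a) * Real.Gamma (2 - 2 * a)) := by
  have G1 := Real.Gamma_pos_of_pos (show 0 < 1 - 2 * a by linarith)
  have G2 := Real.Gamma_pos_of_pos (show 0 < 2 * a by linarith)
  have hcont : ∀ k : ℕ, Continuous (fun x : ℝ => ((1 + x) / 2) ^ k + ((1 - x) / 2) ^ k) := fun k => by fun_prop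
  have hI : ∀ k : ℕ, ∫ x in Ioo (0:ℝ) 1, (((1 + x) / 2) ^ k + ((1 - x) / 2) ^ k) = 2 / (k + 1) := by
    intro k
    rw [← integral_Ioc_eq_integral_Ioo, ← intervalIntegral.integral_of_le zero_le_one,
      intervalIntegral.integral_eq_sub_of_hasDerivAt
        (f := fun x : ℝ => 2 / (k + 1) * (((1 + x) / 2) ^ (k + 1) - ((1 - x) / 2) ^ (k + 1)))]
    · simp
    · intro x _
      have h1 : HasDerivAt (fun x : ℝ => (1 + x) / 2) (1 / 2) x := ((hasDerivAt_id x).const_add 1).div_const 2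
      have h2 : HasDerivAt (fun x : ℝ => (1 - x) / 2) (-1 / 2) x := ((hasDerivAt_id x).const_sub 1).div_const 2
      have := ((h1.pow (k + 1)).sub (h2.pow (k + 1))).const_mul (2 / ((k : ℝ) + 1))
      refine this.congr_deriv ?_
      push_cast
      field_simp
      simp
    · exact (hcont k).intervalIntegrable _ _
  apply T_v1 (s := Ioo (0:ℝ) 1)
    (f := fun k x => cc (2 * a * (1 - 2 * a)) k / 2 * (((1 + x) / 2) ^ k + ((1 - x) / 2) ^ k)) measurableSet_Ioo
  · intro k
    exact (((hcont k).const_mul _).integrableOn_Icc).mono_set Ioo_subset_Icc_self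
  · intro k x hx
    have h1 : 0 ≤ (1 + x) / 2 := by linarith [hx.1]
    have h2 : 0 ≤ (1 - x) / 2 := by linarith [hx.2]
    have := cc_nonneg (ll0 ha ha') k
    positivity
  · intro x hx
    have h := ((cc_summable (ll0 ha ha') (ll1 ha ha') (X := (1 + x) / 2) (by linarith [hx.1]) (by linarith [hx.2])).hasSum.add
      (cc_summable (ll0 ha ha') (ll1 ha ha') (X := (1 - x) / 2) (by linarith [hx.2]) (by linarith [hx.1])).hasSum).div_const 2
    exact hs_congr h (fun k => by ring) rfl
  · have hg := (gauss (A := 1 - 2 * a) (B := 2 * a) (C := 2) (by linarith) (by linarith) (by linarith)).mul_left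
      (1 / (Real.Gamma (1 - 2 * a) * Real.Gamma (2 * a)))
    refine hs_congr hg (fun k => ?_) ?_
    · rw [integral_const_mul, hI, cc_gamma ha ha']
      have e : Real.Gamma (2 + k) = (k + 1) * k.factorial := by
        rw [show (2 : ℝ) + k = (k + 1 : ℕ) + 1 by push_cast; ring, Real.Gamma_nat_eq_factorial, Nat.factorial_succ]
        push_cast; ring
      rw [e]
      have f3 : (k.factorial : ℝ) ≠ 0 := by positivity
      field_simp
    · rw [show (2 : ℝ) - (1 - 2 * a) = 1 + 2 * a by ring, show 1 + 2 * a - 2 * a = (1 : ℝ) by ring, Real.Gamma_one]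
      field_simp

theorem P0_val {a : ℝ} (ha : 0 < a) (ha' : a < 1 / 2) :
    FF a (1 / 2) = √Real.pi / (Real.Gamma (1 / 2 + a) * Real.Gamma (1 - a)) := by
  have h1 := (E_int ha ha' one_pos).2
  simp only [sub_self, Real.rpow_zero, mul_one, Real.Gamma_one, one_pow] at h1
  rw [E_int_one ha ha'] at h1
  have d1 := Real.Gamma_mul_Gamma_add_half (1 / 2 + a)
  have d2 := Real.Gamma_mul_Gamma_add_half (1 - a)
  rw [show 1 / 2 + a + 1 / 2 = 1 + a by ring, show 2 * (1 / 2 + a) = 1 + 2 * a by ring] at d1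
  rw [show 1 - a + 1 / 2 = 1 + 1 / 2 - a by ring, show 2 * (1 - a) = 2 - 2 * a by ring] at d2
  have d3 : (2 : ℝ) ^ (1 - (1 + 2 * a)) * 2 ^ (1 - (2 - 2 * a)) = 1 / 2 := by
    rw [← Real.rpow_add two_pos, show 1 - (1 + 2 * a) + (1 - (2 - 2 * a)) = -1 by ring, Real.rpow_neg_one]; norm_num
  have g1 := (Real.Gamma_pos_of_pos (show 0 < 1 / 2 + a by linarith))
  have g2 := (Real.Gamma_pos_of_pos (show 0 < 1 - a by linarith))
  have g3 := (Real.Gamma_pos_of_pos (show 0 < 1 + a by linarith))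
  have g4 := (Real.Gamma_pos_of_pos (show 0 < 1 + 1 / 2 - a by linarith))
  have g5 := (Real.Gamma_pos_of_pos (show 0 < 1 + 2 * a by linarith))
  have g6 := (Real.Gamma_pos_of_pos (show 0 < 2 - 2 * a by linarith))
  have hpi : 0 < √Real.pi := Real.sqrt_pos.2 Real.pi_pos
  generalize Real.Gamma (1 / 2 + a) = x1 at *
  generalize Real.Gamma (1 - a) = x2 at *
  generalize Real.Gamma (1 + a) = x3 at *
  generalize Real.Gamma (1 + 1 / 2 - a) = x4 at *
  generalize Real.Gamma (1 + 2 * a) = x5 at *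
  generalize Real.Gamma (2 - 2 * a) = x6 at *
  generalize (2 : ℝ) ^ (1 - (1 + 2 * a)) = y1 at *
  generalize (2 : ℝ) ^ (1 - (2 - 2 * a)) = y2 at *
  generalize √Real.pi = p at *
  have d4 : (x1 * x2) * (x3 * x4) = 1 / 2 * p ^ 2 * (x5 * x6) := by
    linear_combination (x2 * x4) * d1 + x5 * y1 * p * d2 + x5 * x6 * p ^ 2 * d3
  rw [div_eq_div_iff (by positivity) (by positivity)] at h1
  rw [eq_div_iff (by positivity)]
  apply mul_right_cancel₀ (show (1 / 2 * p * (x5 * x6)) ≠ 0 by positivity)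
  linear_combination (-(x1 * x2)) * h1 + d4

theorem hasSum_prod_nonneg {f : ℕ × ℕ → ℝ} {g : ℕ → ℝ} {V : ℝ} (hf : ∀ x, 0 ≤ f x)
    (h1 : ∀ n, HasSum (fun l => f (n, l)) (g n)) (h2 : HasSum g V) : HasSum f V := by
  have hs : Summable f := by
    rw [summable_prod_of_nonneg hf]
    refine ⟨fun n => (h1 n).summable, ?_⟩
    simp_rw [fun n => (h1 n).tsum_eq]
    exact h2.summable
  have := hs.hasSum.prod_fiberwise h1
  rw [h2.unique this]; exact hs.hasSum

/-- Beta function -/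
noncomputable def bt (u v : ℝ) : ℝ := Real.Gamma u * Real.Gamma v / Real.Gamma (u + v)

theorem bt_int {u v : ℝ} (hu : 0 < u) (hv : 0 < v) (m n : ℕ) :
    IntegrableOn (fun x : ℝ => x ^ m * (1 - x) ^ n * (x ^ (u - 1) * (1 - x) ^ (v - 1))) (Ioo 0 1) ∧
    ∫ x in Ioo (0:ℝ) 1, x ^ m * (1 - x) ^ n * (x ^ (u - 1) * (1 - x) ^ (v - 1)) = bt (u + m) (v + n) := by
  obtain ⟨b1, b2⟩ := beta_int (u := u + m) (v := v + n) (by positivity) (by positivity)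
  have hpt : ∀ x ∈ Ioo (0:ℝ) 1, x ^ (u + m - 1) * (1 - x) ^ (v + n - 1) =
      x ^ m * (1 - x) ^ n * (x ^ (u - 1) * (1 - x) ^ (v - 1)) := by
    intro x hx
    have h0 : 0 < x := hx.1
    have h1 : 0 < 1 - x := by linarith [hx.2]
    rw [show u + m - 1 = (u - 1) + m by ring, show v + n - 1 = (v - 1) + n by ring,
      Real.rpow_add_natCast h0.ne', Real.rpow_add_natCast h1.ne']
    ring
  refine ⟨b1.congr_fun hpt measurableSet_Ioo, ?_⟩
  rw [← setIntegral_congr_fun measurableSet_Ioo hpt, b2]; rfl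

theorem bt_step1 {u v : ℝ} (hu : 0 < u) (hv : 0 < v) (k : ℕ) (t : ℝ) :
    ∑ j ∈ Finset.range (k + 1), (k.choose j : ℝ) * (-t) ^ j * bt (u + j) v =
      ∑ n ∈ Finset.range (k + 1), (k.choose n : ℝ) * ((1 - t) ^ (k - n) * t ^ n) * bt u (v + n) := by
  have e1 : ∀ j : ℕ, bt (u + j) v = ∫ x in Ioo (0:ℝ) 1, x ^ j * (1 - x) ^ 0 * (x ^ (u - 1) * (1 - x) ^ (v - 1)) := by
    intro j; rw [(bt_int hu hv j 0).2]; simp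
  have e2 : ∀ n : ℕ, bt u (v + n) = ∫ x in Ioo (0:ℝ) 1, x ^ 0 * (1 - x) ^ n * (x ^ (u - 1) * (1 - x) ^ (v - 1)) := by
    intro n; rw [(bt_int hu hv 0 n).2]; simp
  simp_rw [e1, e2, ← integral_const_mul]
  rw [← integral_finsetSum _ (fun j _ => (bt_int hu hv j 0).1.const_mul _),
    ← integral_finsetSum _ (fun n _ => (bt_int hu hv 0 n).1.const_mul _)]
  refine setIntegral_congr_fun measurableSet_Ioo (fun x _ => ?_)
  show ∑ j ∈ Finset.range (k + 1), (k.choose j : ℝ) * (-t) ^ j * (x ^ j * (1 - x) ^ 0 * (x ^ (u - 1) * (1 - x) ^ (v - 1))) =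
    ∑ n ∈ Finset.range (k + 1), (k.choose n : ℝ) * ((1 - t) ^ (k - n) * t ^ n) * (x ^ 0 * (1 - x) ^ n * (x ^ (u - 1) * (1 - x) ^ (v - 1)))
  have p1 : ∑ j ∈ Finset.range (k + 1), (k.choose j : ℝ) * (-t) ^ j * x ^ j = (1 - t * x) ^ k := by
    rw [show 1 - t * x = (-t * x) + 1 by ring, add_pow]
    exact Finset.sum_congr rfl (fun j _ => by rw [mul_pow]; simp; ring)
  have p2 : ∑ n ∈ Finset.range (k + 1), (k.choose n : ℝ) * ((1 - t) ^ (k - n) * t ^ n) * (1 - x) ^ n = (1 - t * x) ^ k := by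
    rw [show 1 - t * x = (t * (1 - x)) + (1 - t) by ring, add_pow]
    exact Finset.sum_congr rfl (fun j _ => by rw [mul_pow]; ring)
  have := congrArg (fun z => z * (x ^ (u - 1) * (1 - x) ^ (v - 1))) (p1.trans p2.symm)
  simp only [Finset.sum_mul] at this
  convert this using 1
  · exact Finset.sum_congr rfl (fun j _ => by ring)
  · exact Finset.sum_congr rfl (fun j _ => by ring)

theorem bt_step2 {u v r s : ℝ} (hu : 0 < u) (hv : 0 < v) (hr : 0 < r) (hs : 0 < s) (k : ℕ) :
    ∑ j ∈ Finset.range (k + 1), (k.choose j : ℝ) * (-1) ^ j * bt (u + j) v * bt (r + j) s =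
      ∑ n ∈ Finset.range (k + 1), (k.choose n : ℝ) * bt u (v + n) * bt (r + n) (s + (k - n : ℕ)) := by
  have e1 : ∀ j : ℕ, bt (r + j) s = ∫ x in Ioo (0:ℝ) 1, x ^ j * (1 - x) ^ 0 * (x ^ (r - 1) * (1 - x) ^ (s - 1)) := by
    intro j; rw [(bt_int hr hs j 0).2]; simp
  have e2 : ∀ n : ℕ, bt (r + n) (s + (k - n : ℕ)) = ∫ x in Ioo (0:ℝ) 1, x ^ n * (1 - x) ^ (k - n) * (x ^ (r - 1) * (1 - x) ^ (s - 1)) := by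
    intro n; rw [(bt_int hr hs n (k - n)).2]
  simp_rw [e1, e2, ← integral_const_mul]
  rw [← integral_finsetSum _ (fun j _ => (bt_int hr hs j 0).1.const_mul _),
    ← integral_finsetSum _ (fun n _ => (bt_int hr hs n (k - n)).1.const_mul _)]
  refine setIntegral_congr_fun measurableSet_Ioo (fun x _ => ?_)
  have := congrArg (fun z => z * (x ^ (r - 1) * (1 - x) ^ (s - 1))) (bt_step1 hu hv k x)
  simp only [Finset.sum_mul] at this
  show ∑ j ∈ Finset.range (k + 1), (k.choose j : ℝ) * (-1) ^ j * bt (u + j) v * (x ^ j * (1 - x) ^ 0 * (x ^ (r - 1) * (1 - x) ^ (s - 1))) =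
    ∑ n ∈ Finset.range (k + 1), (k.choose n : ℝ) * bt u (v + n) * (x ^ n * (1 - x) ^ (k - n) * (x ^ (r - 1) * (1 - x) ^ (s - 1)))
  convert this using 1
  · exact Finset.sum_congr rfl (fun j _ => by rw [neg_pow x]; ring)
  · exact Finset.sum_congr rfl (fun j _ => by ring)

theorem central_gamma (j : ℕ) :
    ((2 * j).choose j : ℝ) * (1 / 4) ^ j = Real.Gamma (j + 1 / 2) / (√Real.pi * j.factorial) := by
  have hpi : 0 < √Real.pi := Real.sqrt_pos.2 Real.pi_pos
  induction j with
  | zero => simp only [Nat.cast_zero, zero_add, Real.Gamma_one_half_eq]; simp; field_simp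
  | succ j ih =>
    have h := congrArg (fun x : ℕ => (x : ℝ)) (Nat.succ_mul_centralBinom_succ j)
    simp only [Nat.centralBinom] at h
    push_cast at h
    have e1 : Real.Gamma ((j + 1 : ℕ) + 1 / 2) = (j + 1 / 2) * Real.Gamma (j + 1 / 2) := by
      rw [← Real.Gamma_add_one (by positivity)]; congr 1; push_cast; ring
    rw [e1, Nat.factorial_succ]
    have p : (j : ℝ) + 1 ≠ 0 := by positivity
    apply mul_left_cancel₀ p
    have f3 : (j.factorial : ℝ) ≠ 0 := by positivity
    rw [eq_div_iff (by positivity)] at ih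
    have e3 : ((j : ℝ) + 1) * ((j + 1 / 2) * Real.Gamma (j + 1 / 2) / (√Real.pi * ((j + 1) * j.factorial : ℝ)))
      = (j + 1 / 2) * (Real.Gamma (j + 1 / 2) / (√Real.pi * j.factorial)) := by
      field_simp
    push_cast
    rw [e3, ← ih]
    rw [pow_succ, ← mul_assoc, ← mul_assoc, h]
    field_simp
    ring

theorem mk_int {a : ℝ} (ha : 0 < a) (ha' : a < 1 / 2) (k : ℕ) :
    IntegrableOn (fun x => (∑ j ∈ Finset.range (k + 1), (k.choose j : ℝ) * ((-1) ^ j * (2 * j).choose j *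
      ((1 + x) / 2 * ((1 - x) / 2)) ^ j)) * (EE a x * (1 - x ^ 2) ^ (a - 1))) (Ioo 0 1) ∧
    ∫ x in Ioo (0:ℝ) 1, (∑ j ∈ Finset.range (k + 1), (k.choose j : ℝ) * ((-1) ^ j * (2 * j).choose j *
      ((1 + x) / 2 * ((1 - x) / 2)) ^ j)) * (EE a x * (1 - x ^ 2) ^ (a - 1)) =
      1 / 2 * FF a (1 / 2) / Real.Gamma (1 - a) * ∑ n ∈ Finset.range (k + 1), (k.choose n : ℝ) *
        (Real.Gamma (a + n) * Real.Gamma (a + (k - n : ℕ)) * Real.Gamma (1 - a + n) /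
          (Real.Gamma (2 * a + k) * n.factorial)) := by
  have G1 := Real.Gamma_pos_of_pos (show 0 < 1 - a by linarith)
  have G2 := Real.Gamma_pos_of_pos ha
  have hpi : 0 < √Real.pi := Real.sqrt_pos.2 Real.pi_pos
  have hpt : ∀ x ∈ Ioo (0:ℝ) 1, ∑ j ∈ Finset.range (k + 1), ((k.choose j : ℝ) * (-1) ^ j * ((2 * j).choose j * (1 / 4) ^ j)) *
      (EE a x * (1 - x ^ 2) ^ (a + j - 1)) = (∑ j ∈ Finset.range (k + 1), (k.choose j : ℝ) * ((-1) ^ j * (2 * j).choose j *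
      ((1 + x) / 2 * ((1 - x) / 2)) ^ j)) * (EE a x * (1 - x ^ 2) ^ (a - 1)) := by
    intro x hx
    rw [Finset.sum_mul]
    refine Finset.sum_congr rfl (fun j _ => ?_)
    have h1 : 0 < 1 - x ^ 2 := by nlinarith [hx.1, hx.2]
    rw [show a + j - 1 = (a - 1) + j by ring, Real.rpow_add_natCast h1.ne',
      show (1 + x) / 2 * ((1 - x) / 2) = 1 / 4 * (1 - x ^ 2) by ring, mul_pow]
    ring
  have hi : ∀ j ∈ Finset.range (k + 1), IntegrableOn (fun x => ((k.choose j : ℝ) * (-1) ^ j * ((2 * j).choose j * (1 / 4) ^ j)) *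
      (EE a x * (1 - x ^ 2) ^ (a + j - 1))) (Ioo 0 1) := fun j _ =>
    (E_int ha ha' (show 0 < a + j by positivity)).1.const_mul _
  constructor
  · exact IntegrableOn.congr_fun (integrable_finsetSum _ hi) hpt measurableSet_Ioo
  · rw [← setIntegral_congr_fun measurableSet_Ioo hpt, integral_finsetSum _ hi]
    simp_rw [integral_const_mul, fun j : ℕ => (E_int ha ha' (show 0 < a + j by positivity)).2]
    have b := bt_step2 (u := a) (v := 1 - a) (r := a) (s := a) ha (by linarith) ha ha k
    have hl : ∀ j : ℕ, (k.choose j : ℝ) * (-1) ^ j * ((2 * j).choose j * (1 / 4) ^ j) *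
      (1 / 2 * FF a (1 / 2) * √Real.pi * Real.Gamma (a + j) ^ 2 / (Real.Gamma (a + j + a) * Real.Gamma (a + j + 1 / 2 - a)))
      = 1 / 2 * FF a (1 / 2) / (Real.Gamma a * Real.Gamma (1 - a)) * ((k.choose j : ℝ) * (-1) ^ j * bt (a + j) (1 - a) * bt (a + j) a) := by
      intro j
      rw [central_gamma, bt, bt, show a + j + (1 - a) = (j : ℝ) + 1 by ring, Real.Gamma_nat_eq_factorial,
        show a + j + 1 / 2 - a = (j : ℝ) + 1 / 2 by ring]
      have g1 := (Real.Gamma_pos_of_pos (show (0 : ℝ) < j + 1 / 2 by positivity)).ne'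
      have g2 := (Real.Gamma_pos_of_pos (show (0 : ℝ) < a + j + a by positivity)).ne'
      have f3 : (j.factorial : ℝ) ≠ 0 := by positivity
      generalize Real.Gamma (j + 1 / 2) = x1 at *
      generalize Real.Gamma (a + j + a) = x2 at *
      field_simp
    rw [Finset.sum_congr rfl (fun j _ => hl j), ← Finset.mul_sum, b, Finset.mul_sum, Finset.mul_sum]
    refine Finset.sum_congr rfl (fun n hn => ?_)
    have hn' : n ≤ k := by simpa [Nat.lt_succ_iff] using hn
    rw [bt, bt, show a + (1 - a + n) = (n : ℝ) + 1 by ring, Real.Gamma_nat_eq_factorial,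
      show a + n + (a + (k - n : ℕ)) = 2 * a + k by rw [Nat.cast_sub hn']; ring]
    field_simp

theorem real_sum {a : ℝ} (ha : 0 < a) (ha' : a < 1 / 2) :
    HasSum (fun k : ℕ => cc (2 * a * (1 - 2 * a)) k * (1 / 2 * FF a (1 / 2) / Real.Gamma (1 - a) * ∑ n ∈ Finset.range (k + 1), (k.choose n : ℝ) *
        (Real.Gamma (a + n) * Real.Gamma (a + (k - n : ℕ)) * Real.Gamma (1 - a + n) /
          (Real.Gamma (2 * a + k) * n.factorial))))
      (1 / 2 * FF a (1 / 2) * Real.Gamma a ^ 4 / (Real.Gamma (1 - a) ^ 2 * Real.Gamma (2 * a) ^ 3)) := by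
  have G1 := Real.Gamma_pos_of_pos (show 0 < 1 - a by linarith)
  have G2 := Real.Gamma_pos_of_pos ha
  have G3 := Real.Gamma_pos_of_pos (show 0 < 1 - 2 * a by linarith)
  have G4 := Real.Gamma_pos_of_pos (show 0 < 2 * a by linarith)
  have hf : HasSum (fun x : ℕ × ℕ => Real.Gamma (a + x.1) * Real.Gamma (1 - a + x.1) / (x.1.factorial : ℝ) ^ 2 *
      (Real.Gamma (1 - 2 * a + x.1 + x.2) * Real.Gamma (a + x.2) / (x.2.factorial * Real.Gamma (x.1 + 1 + x.2))))
      (Real.Gamma a ^ 2 / Real.Gamma (2 * a) *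
        (Real.Gamma (1 - 2 * a) * Real.Gamma a * Real.Gamma a / (Real.Gamma (2 * a) * Real.Gamma (1 - a)))) := by
    refine hasSum_prod_nonneg (g := fun n => Real.Gamma a ^ 2 / Real.Gamma (2 * a) *
      (Real.Gamma (1 - 2 * a + n) * Real.Gamma (a + n) / (n.factorial * Real.Gamma (1 + n)))) ?_ ?_ ?_
    · rintro ⟨n, m⟩
      have p : (0 : ℝ) ≤ n := Nat.cast_nonneg n
      have q : (0 : ℝ) ≤ m := Nat.cast_nonneg m
      have g1 := Real.Gamma_pos_of_pos (show 0 < a + n by linarith)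
      have g2 := Real.Gamma_pos_of_pos (show 0 < a + m by linarith)
      have g3 := Real.Gamma_pos_of_pos (show 0 < 1 - a + n by linarith)
      have g4 := Real.Gamma_pos_of_pos (show 0 < 1 - 2 * a + n + m by linarith)
      have g5 := Real.Gamma_pos_of_pos (show (0 : ℝ) < n + 1 + m by linarith)
      show 0 ≤ Real.Gamma (a + n) * Real.Gamma (1 - a + n) / (n.factorial : ℝ) ^ 2 *
        (Real.Gamma (1 - 2 * a + n + m) * Real.Gamma (a + m) / (m.factorial * Real.Gamma (n + 1 + m)))
      positivity
    · intro n
      have p : (0 : ℝ) ≤ n := Nat.cast_nonneg n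
      have hg := (gauss (A := 1 - 2 * a + n) (B := a) (C := n + 1) (by linarith) ha (by linarith)).mul_left
        (Real.Gamma (a + n) * Real.Gamma (1 - a + n) / (n.factorial : ℝ) ^ 2)
      refine hs_congr hg (fun m => rfl) ?_
      rw [show (n : ℝ) + 1 - (1 - 2 * a + n) = 2 * a by ring, show 2 * a - a = a by ring,
        show (n : ℝ) + 1 - a = 1 - a + n by ring, add_comm 1 (n : ℝ), Real.Gamma_nat_eq_factorial]
      have g3 := (Real.Gamma_pos_of_pos (show 0 < 1 - a + n by linarith)).ne'
      generalize Real.Gamma (1 - a + n) = x3 at *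
      generalize Real.Gamma (1 - 2 * a + n) = x4 at *
      field_simp
    · have hg := (gauss (A := 1 - 2 * a) (B := a) (C := 1) (by linarith) ha (by linarith)).mul_left
        (Real.Gamma a ^ 2 / Real.Gamma (2 * a))
      refine hs_congr hg (fun n => rfl) ?_
      rw [show (1 : ℝ) - (1 - 2 * a) = 2 * a by ring, show 2 * a - a = a by ring]
  have h := ((Finset.HasAntidiagonal.sigmaAntidiagonalEquivProd.hasSum_iff.2 hf).sigma
    (fun k => hasSum_fintype _)).mul_left (1 / 2 * FF a (1 / 2) / (Real.Gamma (1 - a) * Real.Gamma (1 - 2 * a) * Real.Gamma (2 * a)))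
  refine hs_congr h (fun k => ?_) ?_
  · have h3 := Finset.sum_coe_sort (Finset.HasAntidiagonal.antidiagonal k) (fun x : ℕ × ℕ =>
      Real.Gamma (a + x.1) * Real.Gamma (1 - a + x.1) / (x.1.factorial : ℝ) ^ 2 *
      (Real.Gamma (1 - 2 * a + x.1 + x.2) * Real.Gamma (a + x.2) / (x.2.factorial * Real.Gamma (x.1 + 1 + x.2))))
    simp only [Function.comp, Finset.HasAntidiagonal.sigmaAntidiagonalEquivProd, Equiv.coe_fn_mk]
    rw [h3, Finset.Nat.sum_antidiagonal_eq_sum_range_succ_mk, ← mul_assoc, Finset.mul_sum, Finset.mul_sum]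
    refine Finset.sum_congr rfl (fun n hn => ?_)
    have hn' : n ≤ k := by simpa [Nat.lt_succ_iff] using hn
    have c1 : (n : ℝ) + (k - n : ℕ) = k := by rw [Nat.cast_sub hn']; ring
    simp only
    rw [show 1 - 2 * a + n + (k - n : ℕ) = 1 - 2 * a + k by linarith,
      show (n : ℝ) + 1 + (k - n : ℕ) = k + 1 by linarith, Real.Gamma_nat_eq_factorial, cc_gamma ha ha',
      Nat.cast_choose ℝ hn']
    have f1 : (n.factorial : ℝ) ≠ 0 := by positivity
    have f2 : (k.factorial : ℝ) ≠ 0 := by positivity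
    have f3 : ((k - n).factorial : ℝ) ≠ 0 := by positivity
    have g3 := (Real.Gamma_pos_of_pos (show 0 < 2 * a + k by positivity)).ne'
    generalize Real.Gamma (2 * a + k) = x3 at *
    generalize Real.Gamma (1 - 2 * a + k) = x4 at *
    generalize Real.Gamma (1 - a + n) = x5 at *
    generalize Real.Gamma (a + (k - n : ℕ)) = x6 at *
    field_simp
  · field_simp

theorem real_main {a : ℝ} (ha : 0 < a) (ha' : a < 1 / 2) :
    ∫ x in Ioo (0:ℝ) 1, (FF a ((1 + x) / 2) * FF a ((1 - x) / 2)) * (EE a x * (1 - x ^ 2) ^ (a - 1)) =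
      1 / 2 * FF a (1 / 2) * Real.Gamma a ^ 4 / (Real.Gamma (1 - a) ^ 2 * Real.Gamma (2 * a) ^ 3) := by
  apply T_v1 (s := Ioo (0:ℝ) 1) (f := fun k x => cc (2 * a * (1 - 2 * a)) k *
    ((∑ j ∈ Finset.range (k + 1), (k.choose j : ℝ) * ((-1) ^ j * (2 * j).choose j *
      ((1 + x) / 2 * ((1 - x) / 2)) ^ j)) * (EE a x * (1 - x ^ 2) ^ (a - 1)))) measurableSet_Ioo
  · exact fun k => (mk_int ha ha' k).1.const_mul _
  · intro k x hx
    have h1 : 0 ≤ 1 - x ^ 2 := by nlinarith [hx.1, hx.2]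
    have h2 : 0 ≤ (1 - x ^ 2) ^ (a - 1) := Real.rpow_nonneg h1 _
    have h3 := FF_one_le ha ha' (X := (1 + x) / 2) (by linarith [hx.1]) (by linarith [hx.2])
    have h4 := FF_one_le ha ha' (X := (1 - x) / 2) (by linarith [hx.2]) (by linarith [hx.1])
    have h5 : 0 ≤ EE a x := by unfold EE; linarith
    have h6 := cc_nonneg (ll0 ha ha') k
    rw [← pk_identity ((1 + x) / 2) ((1 - x) / 2) (by ring)]
    refine mul_nonneg h6 (mul_nonneg (Finset.sum_nonneg (fun j _ => ?_)) (mul_nonneg h5 h2))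
    positivity
  · intro x hx
    have h := (bailey_k (ll0 ha ha') (ll1 ha ha') (X := (1 + x) / 2) (Y := (1 - x) / 2) (by linarith [hx.1])
      (by linarith [hx.2]) (by ring)).mul_right (EE a x * (1 - x ^ 2) ^ (a - 1))
    exact hs_congr h (fun k => by ring) rfl
  · refine hs_congr (real_sum ha ha') (fun k => ?_) rfl
    rw [integral_const_mul, (mk_int ha ha' k).2]

theorem param_diff {μ : Measure ℝ} {U : Set ℂ} (hU : IsOpen U) (F : ℂ → ℝ → ℂ) (b : ℝ → ℝ)
    (hd : ∀ᵐ x ∂μ, DifferentiableOn ℂ (fun z => F z x) U)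
    (hb : ∀ᵐ x ∂μ, ∀ z ∈ U, ‖F z x‖ ≤ b x) (hbi : Integrable b μ)
    (hm : ∀ z ∈ U, AEStronglyMeasurable (F z) μ) :
    DifferentiableOn ℂ (fun z => ∫ x, F z x ∂μ) U := by
  intro z0 hz0
  obtain ⟨r, hr, hrU⟩ := Metric.isOpen_iff.1 hU z0 hz0
  have hr3 : 0 < r / 3 := by positivity
  have hcl : ∀ z ∈ Metric.ball z0 (r / 3), Metric.closedBall z (r / 3) ⊆ U := by
    intro z hz w hw
    apply hrU
    rw [Metric.mem_ball] at *
    rw [Metric.mem_closedBall] at hw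
    have := dist_triangle w z z0
    linarith
  have hmemU : ∀ z ∈ Metric.ball z0 (r / 3), z ∈ U := fun z hz =>
    hcl z hz (Metric.mem_closedBall_self hr3.le)
  have hda : ∀ᵐ x ∂μ, ∀ z ∈ Metric.ball z0 (r / 3),
      HasDerivAt (fun z => F z x) (deriv (fun z => F z x) z) z := by
    filter_upwards [hd] with x hx z hz
    exact (hx.differentiableAt (hU.mem_nhds (hmemU z hz))).hasDerivAt
  have hz0b : z0 ∈ Metric.ball z0 (r / 3) := Metric.mem_ball_self hr3
  have hbd : ∀ᵐ x ∂μ, ∀ z ∈ Metric.ball z0 (r / 3), ‖deriv (fun z => F z x) z‖ ≤ b x / (r / 3) := by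
    filter_upwards [hd, hb] with x hx hbx z hz
    refine Complex.norm_deriv_le_of_forall_mem_sphere_norm_le hr3 ?_ ?_
    · exact (hx.mono (hcl z hz)).diffContOnCl_ball subset_rfl
    · intro w hw
      exact hbx w (hcl z hz (Metric.sphere_subset_closedBall hw))
  have hmeas : AEStronglyMeasurable (fun x => deriv (fun z => F z x) z0) μ := by
    let t : ℕ → ℂ := fun n => z0 + ((r / 3 / ((n : ℝ) + 2) : ℝ) : ℂ)
    have htm : ∀ n, t n ∈ Metric.ball z0 (r / 3) := by
      intro n
      rw [Metric.mem_ball, Complex.dist_eq]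
      simp only [t, add_sub_cancel_left, Complex.norm_real]
      rw [Real.norm_of_nonneg (by positivity)]
      rw [div_lt_iff₀ (by positivity)]
      have : (0 : ℝ) ≤ n := by positivity
      nlinarith
    have htl : Tendsto t atTop (𝓝[≠] z0) := by
      apply tendsto_nhdsWithin_iff.2
      constructor
      · have h1 : Tendsto (fun n : ℕ => r / 3 / ((n : ℝ) + 2)) atTop (𝓝 0) := by
          apply Tendsto.div_atTop tendsto_const_nhds
          exact tendsto_atTop_add_const_right _ _ tendsto_natCast_atTop_atTop
        have h2 := (Complex.continuous_ofReal.tendsto 0).comp h1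
        have h3 := h2.const_add z0
        simpa [t, Function.comp_def] using h3
      · refine Eventually.of_forall (fun n => ?_)
        have : (r / 3 / ((n : ℝ) + 2)) ≠ 0 := by positivity
        simp only [t, mem_compl_iff, mem_singleton_iff, add_eq_left, Complex.ofReal_eq_zero]
        exact this
    refine aestronglyMeasurable_of_tendsto_ae atTop
      (f := fun (n : ℕ) x => slope (fun z => F z x) z0 (t n)) (fun n => ?_) ?_
    · simp only [slope, vsub_eq_sub]
      exact ((hm _ (hmemU _ (htm n))).sub (hm _ hz0)).const_smul ((t n - z0)⁻¹)
    · filter_upwards [hda] with x hx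
      exact (hx z0 hz0b).tendsto_slope.comp htl
  have := hasDerivAt_integral_of_dominated_loc_of_deriv_le (μ := μ) (F := F)
    (F' := fun z x => deriv (fun z => F z x) z) (x₀ := z0) (bound := fun x => b x / (r / 3))
    (Metric.ball_mem_nhds z0 hr3)
    (by filter_upwards [hU.mem_nhds hz0] with z hz using hm z hz)
    (hbi.mono' (hm z0 hz0) (by filter_upwards [hb] with x hx using hx z0 hz0))
    hmeas hbd (hbi.div_const _) hda
  exact this.2.differentiableAt.differentiableWithinAt

theorem cc_bound {R : ℝ} (hR : 0 ≤ R) {l : ℂ} (hl : ‖l‖ ≤ R) (k : ℕ) :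
    ((k : ℝ) + 1) * ‖cc l (k + 1)‖ ≤ R * Real.exp (R * (1 - 1 / ((k : ℝ) + 1))) := by
  induction k with
  | zero =>
    have := cc_succ l 0
    simp [cc_zero] at this
    simp [this, hl]
  | succ k ih =>
    have h := congrArg norm (cc_succ l (k + 1))
    rw [norm_mul, norm_mul] at h
    have e1 : ‖(((k + 1 : ℕ) : ℂ) + 1) ^ 2‖ = ((k : ℝ) + 2) ^ 2 := by
      rw [norm_pow, show (((k + 1 : ℕ) : ℂ) + 1) = (((k + 2 : ℕ)) : ℂ) by push_cast; ring,
        Complex.norm_natCast]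
      push_cast; ring
    have e2 : ‖((k + 1 : ℕ) : ℂ) * (((k + 1 : ℕ) : ℂ) + 1) + l‖ ≤ ((k : ℝ) + 1) * (k + 2) + R := by
      refine (norm_add_le _ _).trans (add_le_add ?_ hl)
      rw [show ((k + 1 : ℕ) : ℂ) * (((k + 1 : ℕ) : ℂ) + 1) = (((k + 1) * (k + 2) : ℕ) : ℂ) by
        push_cast; ring, Complex.norm_natCast]
      push_cast; exact le_rfl
    rw [e1] at h
    have k0 : (0 : ℝ) ≤ k := by positivity
    have e3 : ((k : ℝ) + 2) * ‖cc l (k + 1 + 1)‖ ≤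
        (1 + R / (((k : ℝ) + 1) * (k + 2))) * (((k : ℝ) + 1) * ‖cc l (k + 1)‖) := by
      have : ‖cc l (k + 1 + 1)‖ * ((k : ℝ) + 2) ^ 2 ≤ ‖cc l (k + 1)‖ * (((k : ℝ) + 1) * (k + 2) + R) := by
        rw [h]; gcongr
      have h2 : (0 : ℝ) < k + 2 := by positivity
      apply le_of_mul_le_mul_right _ h2
      refine le_trans (le_of_eq ?_) (this.trans (le_of_eq ?_))
      · ring
      · field_simp
    have e4 : 1 + R / (((k : ℝ) + 1) * (k + 2)) ≤ Real.exp (R / (((k : ℝ) + 1) * (k + 2))) := by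
      linarith [Real.add_one_le_exp (R / (((k : ℝ) + 1) * (k + 2)))]
    push_cast
    calc ((k : ℝ) + 1 + 1) * ‖cc l (k + 1 + 1)‖ = ((k : ℝ) + 2) * ‖cc l (k + 1 + 1)‖ := by ring
      _ ≤ _ := e3
      _ ≤ Real.exp (R / (((k : ℝ) + 1) * (k + 2))) * (R * Real.exp (R * (1 - 1 / ((k : ℝ) + 1)))) := by
        gcongr
      _ = R * (Real.exp (R / (((k : ℝ) + 1) * (k + 2))) * Real.exp (R * (1 - 1 / ((k : ℝ) + 1)))) := by ring
      _ = _ := by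
        rw [← Real.exp_add]
        congr 2
        field_simp
        ring

theorem cc_bound' {R : ℝ} (hR : 0 ≤ R) {l : ℂ} (hl : ‖l‖ ≤ R) (k : ℕ) :
    ‖cc l (k + 1)‖ ≤ R * Real.exp R / ((k : ℝ) + 1) := by
  rw [le_div_iff₀ (by positivity), mul_comm]
  refine (cc_bound hR hl k).trans ?_
  gcongr
  have : 0 ≤ 1 / ((k : ℝ) + 1) := by positivity
  nlinarith

/-- majorant coefficients -/
noncomputable def mj (R : ℝ) (k : ℕ) : ℝ := if k = 0 then 1 else R * Real.exp R / k

theorem cc_le_mj {R : ℝ} (hR : 0 ≤ R) {l : ℂ} (hl : ‖l‖ ≤ R) (k : ℕ) : ‖cc l k‖ ≤ mj R k := by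
  cases k with
  | zero => simp [mj, cc_zero]
  | succ k => simpa [mj] using cc_bound' hR hl k

theorem mj_hasSum (R : ℝ) {X : ℝ} (h0 : 0 ≤ X) (h1 : X < 1) :
    HasSum (fun k => mj R k * X ^ k) (1 + R * Real.exp R * (-Real.log (1 - X))) := by
  have h := (Real.hasSum_pow_div_log_of_abs_lt_one (x := X) (by rw [abs_of_nonneg h0]; exact h1)).mul_left
    (R * Real.exp R)
  have h2 : HasSum (fun k => mj R (k + 1) * X ^ (k + 1)) (R * Real.exp R * (-Real.log (1 - X))) := by
    refine hs_congr h (fun k => ?_) rfl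
    simp [mj]; ring
  have := (hasSum_nat_add_iff (f := fun k => mj R k * X ^ k) 1).1 h2
  refine hs_congr this (fun k => rfl) ?_
  simp [mj]; ring

theorem mj_le (R : ℝ) (hR : 0 ≤ R) {δ X : ℝ} (hδ : 0 < δ) (h0 : 0 ≤ X) (h1 : X < 1) :
    1 + R * Real.exp R * (-Real.log (1 - X)) ≤ (1 + R * Real.exp R / δ) * (1 - X) ^ (-δ) := by
  have hx : 0 < 1 - X := by linarith
  have e1 : -Real.log (1 - X) ≤ (1 - X) ^ (-δ) / δ := by
    have := Real.log_le_rpow_div (x := (1 - X)⁻¹) (by positivity) hδ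
    rwa [Real.log_inv, Real.inv_rpow hx.le, ← Real.rpow_neg hx.le] at this
  have e2 : 1 ≤ (1 - X) ^ (-δ) := Real.one_le_rpow_of_pos_of_le_one_of_nonpos hx (by linarith) (by linarith)
  have e3 : R * Real.exp R * (-Real.log (1 - X)) ≤ R * Real.exp R * ((1 - X) ^ (-δ) / δ) := by gcongr
  calc _ ≤ (1 - X) ^ (-δ) + R * Real.exp R * ((1 - X) ^ (-δ) / δ) := add_le_add e2 e3
    _ = _ := by ring

/-- the complex Legendre function as series in X = (1-x)/2 -/
noncomputable def LL (ν : ℂ) (X : ℂ) : ℂ := ∑' k, cc (-ν * (ν + 1)) k * X ^ k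

theorem term_le {R : ℝ} (hR : 0 ≤ R) {l : ℂ} (hl : ‖l‖ ≤ R) {X : ℝ} (h0 : 0 ≤ X) (k : ℕ) :
    ‖cc l k * (X : ℂ) ^ k‖ ≤ mj R k * X ^ k := by
  rw [norm_mul, norm_pow, Complex.norm_real, Real.norm_of_nonneg h0]
  gcongr
  exact cc_le_mj hR hl k

theorem LL_summable (ν : ℂ) {X : ℝ} (h0 : 0 ≤ X) (h1 : X < 1) :
    Summable (fun k => cc (-ν * (ν + 1)) k * (X : ℂ) ^ k) :=
  Summable.of_norm_bounded (mj_hasSum _ h0 h1).summable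
    (fun k => term_le (norm_nonneg _) le_rfl h0 k)

theorem LL_bound {R : ℝ} (hR : 0 ≤ R) {ν : ℂ} (hl : ‖-ν * (ν + 1)‖ ≤ R) {δ X : ℝ} (hδ : 0 < δ)
    (h0 : 0 ≤ X) (h1 : X < 1) : ‖LL ν X‖ ≤ (1 + R * Real.exp R / δ) * (1 - X) ^ (-δ) :=
  (tsum_of_norm_bounded (mj_hasSum R h0 h1) (fun k => term_le hR hl h0 k)).trans
    (mj_le R hR hδ h0 h1)

theorem gam_diff (k : ℕ) : Differentiable ℂ (fun ν : ℂ => cc (-ν * (ν + 1)) k) := by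
  unfold cc gam
  have : Differentiable ℂ (fun ν : ℂ => ∏ i ∈ Finset.range k, ((i : ℂ) * (i + 1) + -ν * (ν + 1))) :=
    Differentiable.fun_finsetProd (fun i _ => by fun_prop)
  exact this.div_const _

theorem LL_diff {R : ℝ} (hR : 0 ≤ R) {U : Set ℂ} (hU : IsOpen U)
    (hl : ∀ ν ∈ U, ‖-ν * (ν + 1)‖ ≤ R) {X : ℝ} (h0 : 0 ≤ X) (h1 : X < 1) :
    DifferentiableOn ℂ (fun ν => LL ν X) U := by
  unfold LL
  refine Complex.differentiableOn_tsum_of_summable_norm (mj_hasSum R h0 h1).summable (fun k => ?_) hU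
    (fun k w hw => term_le hR (hl w hw) h0 k)
  exact ((gam_diff k).mul_const _).differentiableOn

theorem LL_meas (ν : ℂ) (s : ℝ → ℝ) (hs : Continuous s) (hm : ∀ x ∈ Ioo (-1 : ℝ) 1, 0 ≤ s x ∧ s x < 1) :
    AEStronglyMeasurable (fun x => LL ν (s x)) (volume.restrict (Ioo (-1 : ℝ) 1)) := by
  refine aestronglyMeasurable_of_tendsto_ae atTop
      (f := fun (n : ℕ) x => ∑ k ∈ Finset.range n, cc (-ν * (ν + 1)) k * (s x : ℂ) ^ k) (fun n => ?_) ?_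
  · apply Continuous.aestronglyMeasurable
    fun_prop
  · rw [ae_restrict_iff' measurableSet_Ioo]
    refine Eventually.of_forall (fun x hx => ?_)
    exact (LL_summable ν (hm x hx).1 (hm x hx).2).hasSum.tendsto_sum_nat

theorem split_int {f : ℝ → ℂ} (hf : IntegrableOn f (Ioo (-1) 1)) :
    ∫ x in (-1 : ℝ)..1, f x = ∫ x in Ioo (0 : ℝ) 1, (f x + f (-x)) := by
  have hi : IntervalIntegrable f volume (-1) 1 := by
    rw [intervalIntegrable_iff_integrableOn_Ioo_of_le (by norm_num)]; exact hf
  have h1 : IntervalIntegrable f volume (-1) 0 := hi.mono_set (by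
    rw [uIcc_of_le (by norm_num), uIcc_of_le (by norm_num)]
    exact Icc_subset_Icc_right (by norm_num))
  have h2 : IntervalIntegrable f volume 0 1 := hi.mono_set (by
    rw [uIcc_of_le (by norm_num), uIcc_of_le (by norm_num)]
    exact Icc_subset_Icc_left (by norm_num))
  have h3 : IntervalIntegrable (fun x => f (-x)) volume 0 1 := by
    have := (IntervalIntegrable.iff_comp_neg (f := f) (a := -1) (b := 0)).1 h1
    simpa using this.symm
  rw [← intervalIntegral.integral_add_adjacent_intervals h1 h2, ← integral_Ioc_eq_integral_Ioo,
    ← intervalIntegral.integral_of_le zero_le_one, intervalIntegral.integral_add h2 h3,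
    intervalIntegral.integral_comp_neg]
  simp [add_comm]

theorem w_int {σ : ℝ} (hσ : 0 < σ) :
    IntegrableOn (fun x : ℝ => (1 - x ^ 2) ^ (σ - 1)) (Ioo (-1) 1) := by
  have h := (beta2 hσ 0).1
  simp only [mul_zero, pow_zero, one_mul] at h
  rw [← intervalIntegrable_iff_integrableOn_Ioo_of_le (by norm_num)] at h ⊢
  have h3 := (IntervalIntegrable.iff_comp_neg (f := (fun x : ℝ => (1 - x ^ 2) ^ (σ - 1))) (a := 0) (b := 1)).1 h
  simp only [neg_sq, neg_zero] at h3
  exact h3.symm.trans h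

/-- weight -/
noncomputable def WW (ν : ℂ) (x : ℝ) : ℂ := (1 - (x : ℂ) ^ 2) ^ ((ν - 1) / 2)

/-- integrand -/
noncomputable def PP (ν : ℂ) (x : ℝ) : ℂ :=
  LL ν (((1 - x) / 2 : ℝ) : ℂ) ^ 2 * LL ν (((1 + x) / 2 : ℝ) : ℂ) * WW ν x

theorem one_sub_sq {x : ℝ} (hx : x ∈ Ioo (-1 : ℝ) 1) : 0 < 1 - x ^ 2 := by
  obtain ⟨h1, h2⟩ := hx; nlinarith

theorem WW_norm (ν : ℂ) {x : ℝ} (hx : x ∈ Ioo (-1 : ℝ) 1) :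
    ‖WW ν x‖ = (1 - x ^ 2) ^ ((ν.re - 1) / 2) := by
  unfold WW
  rw [show (1 - (x : ℂ) ^ 2) = ((1 - x ^ 2 : ℝ) : ℂ) by push_cast; ring,
    Complex.norm_cpow_eq_rpow_re_of_pos (one_sub_sq hx)]
  congr 1
  rw [show (ν - 1) / 2 = ((1 / 2 : ℝ) : ℂ) * (ν - 1) by push_cast; ring, Complex.re_ofReal_mul]
  simp; ring

theorem WW_bound {ν : ℂ} {ε : ℝ} (h : -1 + 2 * ε < ν.re) {x : ℝ} (hx : x ∈ Ioo (-1 : ℝ) 1) :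
    ‖WW ν x‖ ≤ (1 - x ^ 2) ^ (ε - 1) := by
  rw [WW_norm ν hx]
  exact Real.rpow_le_rpow_of_exponent_ge (one_sub_sq hx) (by nlinarith [sq_nonneg x]) (by linarith)

theorem WW_diff {x : ℝ} (hx : x ∈ Ioo (-1 : ℝ) 1) : Differentiable ℂ (fun ν => WW ν x) := by
  unfold WW
  have : (1 - (x : ℂ) ^ 2) ≠ 0 := by
    rw [show (1 - (x : ℂ) ^ 2) = ((1 - x ^ 2 : ℝ) : ℂ) by push_cast; ring]
    exact_mod_cast (one_sub_sq hx).ne'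
  intro ν
  exact DifferentiableAt.const_cpow (by fun_prop) (Or.inl this)

theorem WW_meas (ν : ℂ) : AEStronglyMeasurable (WW ν) (volume.restrict (Ioo (-1 : ℝ) 1)) := by
  apply Measurable.aestronglyMeasurable
  unfold WW
  fun_prop

theorem PP_meas (ν : ℂ) : AEStronglyMeasurable (PP ν) (volume.restrict (Ioo (-1 : ℝ) 1)) := by
  have h1 := LL_meas ν (fun x => (1 - x) / 2) (by fun_prop) (fun x hx => by
    obtain ⟨h1, h2⟩ := hx; constructor <;> linarith)
  have h2 := LL_meas ν (fun x => (1 + x) / 2) (by fun_prop) (fun x hx => by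
    obtain ⟨h1, h2⟩ := hx; constructor <;> linarith)
  exact ((h1.pow 2).mul h2).mul (WW_meas ν)

/-- domain -/
def UU (ε R : ℝ) : Set ℂ := {ν | -1 + 2 * ε < ν.re ∧ ‖ν‖ < R}

theorem UU_open (ε R : ℝ) : IsOpen (UU ε R) :=
  (isOpen_lt continuous_const Complex.continuous_re).inter (isOpen_lt continuous_norm continuous_const)

theorem UU_bd {ε R : ℝ} {ν : ℂ} (h : ν ∈ UU ε R) : ‖-ν * (ν + 1)‖ ≤ R * (R + 1) := by
  rw [norm_mul, norm_neg]
  have h2 : ‖ν + 1‖ ≤ R + 1 := (norm_add_le _ _).trans (by simpa using h.2.le)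
  have h3 := norm_nonneg ν
  have := h.2
  gcongr
  linarith

theorem UU_pos {ε R : ℝ} {ν : ℂ} (h : ν ∈ UU ε R) : 0 ≤ R * (R + 1) :=
  (norm_nonneg _).trans (UU_bd h)

theorem PP_bound {ε R : ℝ} (hε : 0 < ε) {ν : ℂ} (h : ν ∈ UU ε R) {x : ℝ} (hx : x ∈ Ioo (-1 : ℝ) 1) :
    ‖PP ν x‖ ≤ ((1 + R * (R + 1) * Real.exp (R * (R + 1)) / (ε / 4)) * 4 ^ (ε / 4)) ^ 3 *
      (1 - x ^ 2) ^ (ε / 4 - 1) := by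
  have hR := UU_pos h
  have hp := one_sub_sq hx
  obtain ⟨x1, x2⟩ := hx
  set C := 1 + R * (R + 1) * Real.exp (R * (R + 1)) / (ε / 4) with hC
  have hC0 : 0 ≤ C := by positivity
  have key : ∀ X : ℝ, 0 ≤ X → X < 1 → (1 - x ^ 2) / 4 ≤ 1 - X → ‖LL ν X‖ ≤ C * 4 ^ (ε / 4) * (1 - x ^ 2) ^ (-(ε / 4)) := by
    intro X h0 h1 h2
    refine (LL_bound hR (UU_bd h) (δ := ε / 4) (by positivity) h0 h1).trans ?_
    rw [mul_assoc C]
    refine mul_le_mul_of_nonneg_left ?_ hC0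
    refine (Real.rpow_le_rpow_of_nonpos (by positivity) h2 (by linarith)).trans (le_of_eq ?_)
    rw [Real.div_rpow hp.le (by norm_num), Real.rpow_neg (by norm_num : (0 : ℝ) ≤ 4), div_inv_eq_mul, mul_comm]
  have k1 := key ((1 - x) / 2) (by linarith) (by linarith) (by nlinarith)
  have k2 := key ((1 + x) / 2) (by linarith) (by linarith) (by nlinarith)
  have k3 := WW_bound h.1 ⟨x1, x2⟩
  unfold PP
  rw [norm_mul, norm_mul, norm_pow]
  calc _ ≤ (C * 4 ^ (ε / 4) * (1 - x ^ 2) ^ (-(ε / 4))) ^ 2 * (C * 4 ^ (ε / 4) * (1 - x ^ 2) ^ (-(ε / 4)))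
        * (1 - x ^ 2) ^ (ε - 1) := by gcongr
    _ = (C * 4 ^ (ε / 4)) ^ 3 * ((1 - x ^ 2) ^ (-(ε / 4)) * (1 - x ^ 2) ^ (-(ε / 4)) *
        (1 - x ^ 2) ^ (-(ε / 4)) * (1 - x ^ 2) ^ (ε - 1)) := by ring
    _ = _ := by
      rw [← Real.rpow_add hp, ← Real.rpow_add hp, ← Real.rpow_add hp]
      congr 2; ring

theorem mem_UU {ν : ℂ} (h : -1 < ν.re) : ν ∈ UU ((ν.re + 1) / 4) (‖ν‖ + 1) :=
  ⟨by linarith, by linarith⟩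

theorem PP_int {ν : ℂ} (h : -1 < ν.re) : IntegrableOn (PP ν) (Ioo (-1) 1) := by
  have hε : 0 < (ν.re + 1) / 4 := by linarith
  refine Integrable.mono' ((w_int (σ := (ν.re + 1) / 4 / 4) (by positivity)).const_mul ?_) (PP_meas ν) ?_
  · exact ((1 + (‖ν‖ + 1) * ((‖ν‖ + 1) + 1) * Real.exp ((‖ν‖ + 1) * ((‖ν‖ + 1) + 1)) / ((ν.re + 1) / 4 / 4)) * 4 ^ ((ν.re + 1) / 4 / 4)) ^ 3
  · rw [ae_restrict_iff' measurableSet_Ioo]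
    exact Eventually.of_forall (fun x hx => PP_bound hε (mem_UU h) hx)

theorem WW_int {ν : ℂ} (h : -1 < ν.re) : IntegrableOn (WW ν) (Ioo (-1) 1) := by
  have hε : 0 < (ν.re + 1) / 4 := by linarith
  refine Integrable.mono' (w_int hε) (WW_meas ν) ?_
  rw [ae_restrict_iff' measurableSet_Ioo]
  exact Eventually.of_forall (fun x hx => WW_bound (mem_UU h).1 hx)

theorem glob_diff {f : ℂ → ℂ} (h : ∀ ε R : ℝ, 0 < ε → DifferentiableOn ℂ f (UU ε R)) :
    DifferentiableOn ℂ f {ν | -1 < ν.re} := by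
  intro ν hν
  have hν' : -1 < ν.re := hν
  exact ((h ((ν.re + 1) / 4) (‖ν‖ + 1) (by linarith)).differentiableAt
    ((UU_open _ _).mem_nhds (mem_UU hν'))).differentiableWithinAt

theorem PP_diff : DifferentiableOn ℂ (fun ν => ∫ x in Ioo (-1 : ℝ) 1, PP ν x) {ν | -1 < ν.re} := by
  refine glob_diff (fun ε R hε => ?_)
  rcases (UU ε R).eq_empty_or_nonempty with h | ⟨ν0, h0⟩
  · rw [h]; exact differentiableOn_empty
  have hR := UU_pos h0
  refine param_diff (UU_open ε R) PP _ ?_ ?_ ((w_int (σ := ε / 4) (by positivity)).const_mul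
    (((1 + R * (R + 1) * Real.exp (R * (R + 1)) / (ε / 4)) * 4 ^ (ε / 4)) ^ 3)) (fun z _ => PP_meas z)
  · rw [ae_restrict_iff' measurableSet_Ioo]
    refine Eventually.of_forall (fun x hx => ?_)
    obtain ⟨x1, x2⟩ := hx
    have d1 := LL_diff hR (UU_open ε R) (fun ν h => UU_bd h) (X := (1 - x) / 2) (by linarith) (by linarith)
    have d2 := LL_diff hR (UU_open ε R) (fun ν h => UU_bd h) (X := (1 + x) / 2) (by linarith) (by linarith)
    exact ((d1.pow 2).mul d2).mul (WW_diff ⟨x1, x2⟩).differentiableOn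
  · rw [ae_restrict_iff' measurableSet_Ioo]
    exact Eventually.of_forall (fun x hx z hz => PP_bound hε hz hx)

theorem WWi_diff : DifferentiableOn ℂ (fun ν => ∫ x in Ioo (-1 : ℝ) 1, WW ν x) {ν | -1 < ν.re} := by
  refine glob_diff (fun ε R hε => ?_)
  refine param_diff (UU_open ε R) WW _ ?_ ?_ (w_int hε) (fun z _ => WW_meas z)
  · rw [ae_restrict_iff' measurableSet_Ioo]
    exact Eventually.of_forall (fun x hx => (WW_diff hx).differentiableOn)
  · rw [ae_restrict_iff' measurableSet_Ioo]
    exact Eventually.of_forall (fun x hx z hz => WW_bound hz.1 hx)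

theorem LLh_diff : DifferentiableOn ℂ (fun ν => LL ν ((1 / 2 : ℝ) : ℂ)) {ν | -1 < ν.re} := by
  refine glob_diff (fun ε R hε => ?_)
  rcases (UU ε R).eq_empty_or_nonempty with h | ⟨ν0, h0⟩
  · rw [h]; exact differentiableOn_empty
  exact LL_diff (UU_pos h0) (UU_open ε R) (fun ν h => UU_bd h) (by norm_num) (by norm_num)

theorem cc_ofReal (l : ℝ) (k : ℕ) : cc (l : ℂ) k = ((cc l k : ℝ) : ℂ) := by
  unfold cc gam; push_cast; rfl

theorem LL_real (a X : ℝ) : LL ((2 * a - 1 : ℝ) : ℂ) (X : ℂ) = ((FF a X : ℝ) : ℂ) := by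
  unfold LL FF
  rw [Complex.ofReal_tsum]
  refine tsum_congr (fun k => ?_)
  rw [Complex.ofReal_mul, Complex.ofReal_pow, ← cc_ofReal]
  congr 2; push_cast; ring

theorem WW_real (a : ℝ) {x : ℝ} (hx : x ∈ Ioo (-1 : ℝ) 1) :
    WW ((2 * a - 1 : ℝ) : ℂ) x = (((1 - x ^ 2) ^ (a - 1) : ℝ) : ℂ) := by
  unfold WW
  rw [Complex.ofReal_cpow (one_sub_sq hx).le]
  congr 1 <;> push_cast <;> ring

theorem WW_val {a : ℝ} (ha : 0 < a) : ∫ x in Ioo (-1 : ℝ) 1, WW ((2 * a - 1 : ℝ) : ℂ) x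
    = ((√Real.pi * Real.Gamma a / Real.Gamma (1 / 2 + a) : ℝ) : ℂ) := by
  rw [← integral_Ioc_eq_integral_Ioo, ← intervalIntegral.integral_of_le (by norm_num),
    split_int (WW_int (by rw [Complex.ofReal_re]; linarith))]
  have hb := (beta2 ha 0).2
  simp only [mul_zero, pow_zero, one_mul, Nat.cast_zero, add_zero] at hb
  rw [show √Real.pi * Real.Gamma a / Real.Gamma (1 / 2 + a) =
    2 * (1 / 2 * (Real.Gamma (1 / 2) * Real.Gamma a / Real.Gamma (1 / 2 + a))) by
      rw [Real.Gamma_one_half_eq]; ring, ← hb, ← integral_const_mul, ← integral_complex_ofReal]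
  refine setIntegral_congr_fun measurableSet_Ioo (fun x hx => ?_)
  obtain ⟨x1, x2⟩ := hx
  show _ + _ = _
  rw [WW_real a ⟨by linarith, x2⟩, WW_real a ⟨by linarith, by linarith⟩, neg_sq]
  push_cast; ring

theorem PP_val {a : ℝ} (ha : 0 < a) (ha' : a < 1 / 2) : ∫ x in Ioo (-1 : ℝ) 1, PP ((2 * a - 1 : ℝ) : ℂ) x
    = ((FF a (1 / 2) * Real.Gamma a ^ 4 / (Real.Gamma (1 - a) ^ 2 * Real.Gamma (2 * a) ^ 3) : ℝ) : ℂ) := by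
  rw [← integral_Ioc_eq_integral_Ioo, ← intervalIntegral.integral_of_le (by norm_num),
    split_int (PP_int (by rw [Complex.ofReal_re]; linarith))]
  rw [show FF a (1 / 2) * Real.Gamma a ^ 4 / (Real.Gamma (1 - a) ^ 2 * Real.Gamma (2 * a) ^ 3) =
    2 * (1 / 2 * FF a (1 / 2) * Real.Gamma a ^ 4 / (Real.Gamma (1 - a) ^ 2 * Real.Gamma (2 * a) ^ 3)) by ring,
    ← real_main ha ha', ← integral_const_mul, ← integral_complex_ofReal]
  refine setIntegral_congr_fun measurableSet_Ioo (fun x hx => ?_)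
  obtain ⟨x1, x2⟩ := hx
  simp only [PP, EE]
  rw [WW_real a ⟨by linarith, x2⟩, WW_real a ⟨by linarith, by linarith⟩, neg_sq, LL_real, LL_real, LL_real, LL_real,
    sub_neg_eq_add, ← sub_eq_add_neg]
  push_cast; ring

theorem const_real {a : ℝ} (ha : 0 < a) (ha' : a < 1 / 2) :
    FF a (1 / 2) * Real.Gamma a ^ 4 / (Real.Gamma (1 - a) ^ 2 * Real.Gamma (2 * a) ^ 3)
      = (FF a (1 / 2) / 2 ^ (2 * a - 1)) ^ 3 * (√Real.pi * Real.Gamma a / Real.Gamma (1 / 2 + a)) := by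
  have hd := Real.Gamma_mul_Gamma_add_half a
  rw [P0_val ha ha', div_eq_mul_inv _ ((2 : ℝ) ^ (2 * a - 1)), ← Real.rpow_neg (by norm_num), show -(2 * a - 1) = 1 - 2 * a by ring]
  rw [add_comm a] at hd
  have g1 : Real.Gamma (1 / 2 + a) ≠ 0 := (Real.Gamma_pos_of_pos (by linarith)).ne'
  have g2 : Real.Gamma (1 - a) ≠ 0 := (Real.Gamma_pos_of_pos (by linarith)).ne'
  have g3 : Real.Gamma (2 * a) ≠ 0 := (Real.Gamma_pos_of_pos (by linarith)).ne'
  have hs : √Real.pi ≠ 0 := (Real.sqrt_pos.2 Real.pi_pos).ne'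
  generalize Real.Gamma (1 / 2 + a) = x at *
  generalize Real.Gamma (1 - a) = y at *
  generalize Real.Gamma (2 * a) = z at *
  generalize Real.Gamma a = g at *
  generalize (2 : ℝ) ^ (1 - 2 * a) = t at *
  generalize √Real.pi = s at *
  field_simp
  have : g ^ 3 * x ^ 3 = (z * t * s) ^ 3 := by rw [← hd]; ring
  linear_combination g * this

theorem main_LL {ν : ℂ} (hν : -1 < ν.re) :
    ∫ x in Ioo (-1 : ℝ) 1, PP ν x
      = (LL ν ((1 / 2 : ℝ) : ℂ) / 2 ^ ν) ^ 3 * ∫ x in Ioo (-1 : ℝ) 1, WW ν x := by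
  have hop : IsOpen {ν : ℂ | -1 < ν.re} := isOpen_lt continuous_const Complex.continuous_re
  have hpc : IsPreconnected {ν : ℂ | -1 < ν.re} := (convex_halfSpace_re_gt (-1)).isPreconnected
  have h2 : Differentiable ℂ (fun ν : ℂ => (2 : ℂ) ^ ν) := fun ν =>
    DifferentiableAt.const_cpow (by fun_prop) (Or.inl (by norm_num))
  have h2n : ∀ ν : ℂ, (2 : ℂ) ^ ν ≠ 0 := fun ν => by simp [Complex.cpow_eq_zero_iff]
  have hr : DifferentiableOn ℂ (fun ν => (LL ν ((1 / 2 : ℝ) : ℂ) / 2 ^ ν) ^ 3 * ∫ x in Ioo (-1 : ℝ) 1, WW ν x)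
      {ν | -1 < ν.re} :=
    ((LLh_diff.div h2.differentiableOn (fun ν _ => h2n ν)).pow 3).mul WWi_diff
  refine (PP_diff.analyticOnNhd hop).eqOn_of_preconnected_of_frequently_eq (hr.analyticOnNhd hop) hpc
    (z₀ := ((-1 / 2 : ℝ) : ℂ)) (by rw [mem_ofPred_eq, Complex.ofReal_re]; norm_num) ?_ hν
  apply freq_ofReal
  filter_upwards [Ioo_mem_nhdsGT (show (-1 / 2 : ℝ) < 0 by norm_num)] with t ht
  obtain ⟨t1, t2⟩ := ht
  obtain ⟨a, rfl⟩ : ∃ a : ℝ, t = 2 * a - 1 := ⟨(t + 1) / 2, by ring⟩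
  have ha : 0 < a := by linarith
  have ha' : a < 1 / 2 := by linarith
  rw [PP_val ha ha', WW_val ha, LL_real, const_real ha ha']
  have : (2 : ℂ) ^ ((2 * a - 1 : ℝ) : ℂ) = (((2 : ℝ) ^ (2 * a - 1) : ℝ) : ℂ) := by
    rw [Complex.ofReal_cpow (by norm_num)]; norm_num
  rw [this]
  push_cast; rfl

theorem hyper_eq (ν X : ℂ) : ordinaryHypergeometric (-ν) (ν + 1) 1 X = LL ν X := by
  rw [ordinaryHypergeometric_eq_tsum]
  unfold LL
  refine tsum_congr (fun k => ?_)
  have h1 : (ascPochhammer ℂ k).eval 1 = (k.factorial : ℂ) := by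
    rw [ascPochhammer_eval_one]
  have h2 : (ascPochhammer ℂ k).eval (-ν) * (ascPochhammer ℂ k).eval (ν + 1) = gam (-ν * (ν + 1)) k := by
    induction k with
    | zero => simp [gam]
    | succ k ih =>
      rw [gam_succ, ← ih (by rw [ascPochhammer_eval_one]), ascPochhammer_succ_eval, ascPochhammer_succ_eval]
      ring
  rw [h1, cc, ← h2, smul_eq_mul]
  field_simp

end HelperPart

open Real MeasureTheory intervalIntegral Complex

theorem legendreP_eq (ν x : ℂ) : legendreP ν x = LL ν ((1 - x) / 2) := hyper_eq ν _

theorem stmt15 (ν : ℂ) (hν : -1 < ν.re) :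
    (∫ x in (-1:ℝ)..1, (legendreP ν (x : ℂ)) ^ 2 * legendreP ν (-(x : ℂ)) *
        ((1 - (x:ℂ) ^ 2) ^ ((ν - 1)/2)))
      = (legendreP ν 0 / 2 ^ ν) ^ 3 *
        ∫ x in (-1:ℝ)..1, ((1 - (x:ℂ) ^ 2) ^ ((ν - 1)/2)) := by
  have h := main_LL hν
  rw [← integral_Ioc_eq_integral_Ioo, ← integral_Ioc_eq_integral_Ioo,
    ← intervalIntegral.integral_of_le (by norm_num),
    ← intervalIntegral.integral_of_le (by norm_num)] at h
  have e0 : legendreP ν 0 = LL ν ((1 / 2 : ℝ) : ℂ) := by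
    rw [legendreP_eq]; congr 1; push_cast; ring
  rw [e0]
  refine Eq.trans (intervalIntegral.integral_congr (fun x _ => ?_)) h
  show _ = PP ν x
  unfold PP WW
  rw [legendreP_eq, legendreP_eq]
  push_cast
  rw [sub_neg_eq_add]
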